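/- arXiv:2009.06729 — 4 statements merged into one kernel-verified Lean document; each statement's English description precedes it below -/
import Mathlib

section
/- Let (X, μ) be a finite nonatomic measure space, let f ∈ L¹(X, μ), and let E ⊆ X be measurable with μ(E) > 0. Define f' : X → ℝ by f' = ⨍_E f (the average of f over E) on E and f' = f on X ∖ E. Then f' belongs to the closure, in the L¹(X, μ) topology, of the convex hull of the set {η ∈ L¹(X, μ) : η is equidistributed with f}. -/
open scoped Classical

open MeasureTheory

/-- A measure is nonatomic if every set of positive measure contains a subset of
strictly smaller positive measure. -/
def Nonatomic {X : Type*} [MeasurableSpace X] (μ : Measure X) : Prop :=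
  ∀ s : Set X, MeasurableSet s → 0 < μ s →
    ∃ t, t ⊆ s ∧ MeasurableSet t ∧ 0 < μ t ∧ μ t < μ s

open Set Filter Topology ProbabilityTheory unitInterval
open scoped ENNReal

namespace Nonatomic

variable {X : Type*} [MeasurableSpace X] {μ : Measure X}

lemma exists_subset_le_half (hμ : Nonatomic μ) {s : Set X} (hs : MeasurableSet s) (hpos : 0 < μ s) :
    ∃ t ⊆ s, MeasurableSet t ∧ 0 < μ t ∧ μ t ≤ μ s / 2 := by
  obtain ⟨t, hts, ht, ht0, hlt⟩ := hμ s hs hpos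
  have hadd : μ t + μ (s \ t) = μ s := by
    rw [measure_add_sdiff ht.nullMeasurableSet, union_eq_self_of_subset_left hts]
  rcases le_total (μ t) (μ (s \ t)) with h | h
  · refine ⟨t, hts, ht, ht0, ?_⟩
    rw [ENNReal.le_div_iff_mul_le (by simp) (by simp), mul_two, ← hadd]
    gcongr
  · refine ⟨s \ t, sdiff_subset, hs.diff ht, ?_, ?_⟩
    · rw [pos_iff_ne_zero]
      intro h0
      rw [h0, add_zero] at hadd
      exact hlt.ne hadd
    · rw [ENNReal.le_div_iff_mul_le (by simp) (by simp), mul_two, ← hadd]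
      gcongr

lemma exists_subset_le [IsFiniteMeasure μ] (hμ : Nonatomic μ) {s : Set X} (hs : MeasurableSet s)
    (hpos : 0 < μ s) {ε : ℝ≥0∞} (hε : ε ≠ 0) :
    ∃ t ⊆ s, MeasurableSet t ∧ 0 < μ t ∧ μ t ≤ ε := by
  have key : ∀ n : ℕ, ∃ t ⊆ s, MeasurableSet t ∧ 0 < μ t ∧ μ t ≤ μ s * 2⁻¹ ^ n := by
    intro n
    induction n with
    | zero => exact ⟨s, Subset.rfl, hs, hpos, by simp⟩
    | succ n ih =>
      obtain ⟨t, hts, ht, ht0, hle⟩ := ih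
      obtain ⟨u, hut, hu, hu0, hule⟩ := hμ.exists_subset_le_half ht ht0
      refine ⟨u, hut.trans hts, hu, hu0, hule.trans ?_⟩
      rw [pow_succ, ← mul_assoc, ENNReal.div_eq_inv_mul, mul_comm]
      gcongr
  have hlim : Tendsto (fun n : ℕ => μ s * 2⁻¹ ^ n) atTop (𝓝 0) := by
    have := ENNReal.Tendsto.const_mul (a := μ s)
      (ENNReal.tendsto_pow_atTop_nhds_zero_of_lt_one (r := 2⁻¹) (by simp))
      (Or.inr (measure_ne_top μ s))
    simpa using this
  obtain ⟨n, hn⟩ := (hlim.eventually_le_const (pos_iff_ne_zero.2 hε)).exists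
  obtain ⟨t, hts, ht, ht0, hle⟩ := key n
  exact ⟨t, hts, ht, ht0, hle.trans hn⟩

lemma exists_countable_cover [IsFiniteMeasure μ] (hμ : Nonatomic μ) {ε : ℝ≥0∞} (hε : ε ≠ 0) :
    ∃ C : ℕ → Set X, (∀ k, MeasurableSet (C k) ∧ μ (C k) ≤ ε) ∧ μ (⋃ k, C k)ᶜ = 0 := by
  let Small : Set (Set (Set X)) := {D | D.Countable ∧ ∀ t ∈ D, MeasurableSet t ∧ μ t ≤ ε}
  have hne : ((fun D => μ (⋃₀ D)) '' Small).Nonempty := ⟨_, ∅, ⟨countable_empty, by simp⟩, rfl⟩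
  obtain ⟨u, -, hu, huS⟩ := exists_seq_tendsto_sSup hne (OrderTop.bddAbove _)
  choose D hD hDu using huS
  have hsmall : insert ∅ (⋃ n, D n) ∈ Small := by
    refine ⟨(countable_iUnion fun n => (hD n).1).insert _, ?_⟩
    rintro t (rfl | ht)
    · simp
    · obtain ⟨n, hn⟩ := mem_iUnion.1 ht
      exact (hD n).2 t hn
  obtain ⟨C, hC⟩ := hsmall.1.exists_eq_range (insert_nonempty _ _)
  have hCs : ∀ k, MeasurableSet (C k) ∧ μ (C k) ≤ ε := fun k =>
    hsmall.2 _ (hC ▸ mem_range_self k)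
  refine ⟨C, hCs, ?_⟩
  by_contra h0
  have hCm : MeasurableSet (⋃ k, C k) := .iUnion fun k => (hCs k).1
  obtain ⟨t, htC, ht, ht0, htε⟩ := hμ.exists_subset_le hCm.compl (pos_iff_ne_zero.2 h0) hε
  have hsup : sSup ((fun D => μ (⋃₀ D)) '' Small) ≤ μ (⋃ k, C k) := by
    refine le_of_tendsto' hu fun n => ?_
    rw [← hDu n, ← sUnion_range, ← hC]
    exact measure_mono (sUnion_subset_sUnion ((subset_iUnion D n).trans (subset_insert _ _)))
  have hle : μ (t ∪ ⋃ k, C k) ≤ sSup ((fun D => μ (⋃₀ D)) '' Small) := by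
    refine le_sSup ⟨insert t (range C), ⟨(countable_range C).insert _, ?_⟩, ?_⟩
    · rintro _ (rfl | ⟨k, rfl⟩)
      exacts [⟨ht, htε⟩, hCs k]
    · simp [sUnion_insert]
  rw [measure_union (disjoint_left.2 fun x hx => htC hx) hCm] at hle
  refine (ENNReal.lt_add_right (measure_ne_top μ (⋃ k, C k)) ht0.ne').not_ge ?_
  rw [add_comm]
  exact hle.trans hsup

/-- A finite nonatomic measure space carries a real random variable whose level sets are null. -/
lemma exists_measurable_preimage_singleton_null [IsFiniteMeasure μ] (hμ : Nonatomic μ) :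
    ∃ u : X → ℝ, Measurable u ∧ ∀ a, μ (u ⁻¹' {a}) = 0 := by
  have hε : ∀ n : ℕ, ((n : ℝ≥0∞) + 1)⁻¹ ≠ 0 := fun n => by simp
  choose C hC hC0 using fun n => hμ.exists_countable_cover (hε n)
  let b : X → ℕ × ℕ → Bool := fun x p => decide (x ∈ C p.1 p.2)
  have hb : Measurable b := measurable_pi_lambda _ fun p =>
    measurable_to_bool (by
      convert (hC p.1 p.2).1 using 1
      ext x
      simp [b])
  have hb0 : ∀ c, μ (b ⁻¹' {c}) = 0 := by
    intro c
    have hle : ∀ n : ℕ, μ (b ⁻¹' {c}) ≤ ((n : ℝ≥0∞) + 1)⁻¹ := by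
      intro n
      by_cases h : ∃ k, c (n, k) = true
      · obtain ⟨k, hk⟩ := h
        refine (measure_mono ?_).trans (hC n k).2
        rintro x rfl
        simpa [b] using hk
      · refine (measure_mono_null ?_ (hC0 n)).le.trans zero_le
        rintro x rfl
        simpa [b] using h
    have hlim : Tendsto (fun n : ℕ => ((n : ℝ≥0∞) + 1)⁻¹) atTop (𝓝 0) := by
      have := (tendsto_add_atTop_iff_nat 1).2 ENNReal.tendsto_inv_nat_nhds_zero
      simpa using this
    exact le_antisymm (ge_of_tendsto' hlim hle) zero_le
  have he := measurableEmbedding_embeddingReal (ℕ × ℕ → Bool)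
  refine ⟨embeddingReal _ ∘ b, he.measurable.comp hb, fun a => ?_⟩
  rw [preimage_comp]
  by_cases ha : ∃ c, embeddingReal (ℕ × ℕ → Bool) c = a
  · obtain ⟨c, rfl⟩ := ha
    rw [← image_singleton, he.injective.preimage_image]
    exact hb0 c
  · convert measure_empty (μ := μ)
    ext x
    simpa using fun h => ha ⟨_, h⟩

end Nonatomic

lemma continuous_cdf (ν : Measure ℝ) [IsProbabilityMeasure ν] [NullSingletonClass ν] :
    Continuous (cdf ν) := by
  refine continuous_iff_continuousAt.2 fun a => ?_
  rw [(monotone_cdf ν).continuousAt_iff_leftLim_eq_rightLim, StieltjesFunction.rightLim_eq]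
  refine le_antisymm ((monotone_cdf ν).leftLim_le le_rfl) ?_
  have h := (cdf ν).measure_singleton a
  rw [measure_cdf, measure_singleton, eq_comm, ENNReal.ofReal_eq_zero] at h
  linarith

/-- The cdf of an atomless law transports this law to the uniform law on the unit interval. -/
lemma map_cdf_eq_volume (ν : Measure ℝ) [IsProbabilityMeasure ν] [NullSingletonClass ν] :
    ν.map (fun x => (⟨cdf ν x, cdf_nonneg ν x, cdf_le_one ν x⟩ : I)) = volume := by
  have hm : Measurable (fun x => (⟨cdf ν x, cdf_nonneg ν x, cdf_le_one ν x⟩ : I)) :=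
    (monotone_cdf ν).measurable.subtype_mk
  have hivt : ∀ t : ℝ, 0 < t → t < 1 → ∃ a, cdf ν a = t := fun t h0 h1 =>
    mem_range_of_exists_le_of_exists_ge (continuous_cdf ν)
      ((tendsto_cdf_atBot ν).eventually_le_const h0).exists
      ((tendsto_cdf_atTop ν).eventually_const_le h1).exists
  refine Measure.ext_of_Iic _ _ fun t => ?_
  rw [Measure.map_apply hm measurableSet_Iic, unitInterval.volume_Iic]
  change ν {x | cdf ν x ≤ t} = _
  rcases t with ⟨t, h0, h1⟩
  change ν {x | cdf ν x ≤ t} = ENNReal.ofReal t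
  rcases h1.eq_or_lt with rfl | h1
  · simp [cdf_le_one]
  apply le_antisymm
  · refine ge_of_tendsto (x := 𝓝[>] t)
      ((ENNReal.continuous_ofReal.tendsto t).mono_left nhdsWithin_le_nhds) ?_
    filter_upwards [Ioo_mem_nhdsGT h1] with s hs
    obtain ⟨a, rfl⟩ := hivt s (h0.trans_lt hs.1) hs.2
    rw [ofReal_cdf]
    refine measure_mono fun x (hx : cdf ν x ≤ t) => ?_
    by_contra hxa
    exact absurd (monotone_cdf ν (not_le.1 hxa).le) (not_le.2 (hx.trans_lt hs.1))
  · rcases h0.eq_or_lt with rfl | h0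
    · simp
    obtain ⟨a, rfl⟩ := hivt t h0 h1
    rw [ofReal_cdf]
    exact measure_mono fun x hx => monotone_cdf ν hx

/-- If a probability space carries a real random variable with null level sets, then every
probability law on a standard Borel space is the law of some random variable on it. -/
lemma exists_measurable_map_eq_of_preimage_singleton_null {X Y : Type*} [MeasurableSpace X]
    [MeasurableSpace Y] [StandardBorelSpace Y] [Nonempty Y] {P : Measure X} [IsProbabilityMeasure P]
    {u : X → ℝ} (hu : Measurable u) (hu0 : ∀ a, P (u ⁻¹' {a}) = 0)
    (ν : Measure Y) [IsProbabilityMeasure ν] :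
    ∃ Z : X → Y, Measurable Z ∧ P.map Z = ν := by
  obtain ⟨g, hg, hgν⟩ := ν.exists_measurable_map_eq
  have : IsProbabilityMeasure (P.map u) := Measure.isProbabilityMeasure_map hu.aemeasurable
  have : NullSingletonClass (P.map u) :=
    ⟨fun a => by rw [Measure.map_apply hu (measurableSet_singleton a), hu0]⟩
  have hF : Measurable (fun x => (⟨cdf (P.map u) x, cdf_nonneg _ x, cdf_le_one _ x⟩ : I)) :=
    (monotone_cdf _).measurable.subtype_mk
  refine ⟨_, hg.comp (hF.comp hu), ?_⟩
  rw [← Measure.map_map hg (hF.comp hu), ← Measure.map_map hF hu, map_cdf_eq_volume, hgν]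

lemma map_ite_eq_of_map_cond_eq {X : Type*} [MeasurableSpace X] {μ : Measure X} [IsFiniteMeasure μ]
    {E : Set X} (hE : MeasurableSet E) (hE0 : μ E ≠ 0) {f g : X → ℝ} (hf : Measurable f)
    (hg : Measurable g) (h : μ[|E].map g = μ[|E].map f) :
    μ.map (fun x => if x ∈ E then g x else f x) = μ.map f := by
  have hm : Measurable (fun x => if x ∈ E then g x else f x) := Measurable.ite hE hg hf
  ext B hB
  have hB' : μ (E ∩ g ⁻¹' B) = μ (E ∩ f ⁻¹' B) := by
    have := congrArg (fun ν => ν B) h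
    simp only [Measure.map_apply hg hB, Measure.map_apply hf hB, cond_apply hE] at this
    exact (ENNReal.mul_right_inj (by simp) (by simpa using hE0)).1 this
  rw [Measure.map_apply hm hB, Measure.map_apply hf hB,
    ← measure_inter_add_sdiff _ hE, ← measure_inter_add_sdiff (f ⁻¹' B) hE]
  congr 1
  · rw [inter_comm (f ⁻¹' B), ← hB']
    congr 1
    ext x
    by_cases hx : x ∈ E <;> simp [hx]
  · congr 1
    ext x
    by_cases hx : x ∈ E <;> simp [hx]

/-- A probability space with a random variable with null level sets carries an i.i.d. sequence
whose common law is that of a given integrable `f`; its averages converge in `L¹`. -/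
lemma exists_seq_map_eq_tendsto_average {X : Type*} [MeasurableSpace X] {P : Measure X}
    [IsProbabilityMeasure P] {u : X → ℝ} (hu : Measurable u) (hu0 : ∀ a, P (u ⁻¹' {a}) = 0)
    {f : X → ℝ} (hf : Measurable f) (hfi : Integrable f P) :
    ∃ Z : ℕ → X → ℝ, (∀ k, Measurable (Z k) ∧ P.map (Z k) = P.map f) ∧
      Tendsto (fun n : ℕ => eLpNorm
        (fun x => (n : ℝ)⁻¹ • (∑ k ∈ Finset.range n, Z k x) - ∫ y, f y ∂P) 1 P) atTop (𝓝 0) := by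
  have : IsProbabilityMeasure (P.map f) := Measure.isProbabilityMeasure_map hf.aemeasurable
  obtain ⟨Z, hZ, hZP⟩ := exists_measurable_map_eq_of_preimage_singleton_null hu hu0
    (Measure.infinitePi fun _ : ℕ => P.map f)
  have hZk : ∀ k, Measurable fun x => Z x k := fun k => (measurable_pi_apply k).comp hZ
  have hlaw : ∀ k, P.map (fun x => Z x k) = P.map f := by
    intro k
    rw [← (measurePreserving_eval_infinitePi (fun _ : ℕ => P.map f) k).map_eq, ← hZP,
      Measure.map_map (measurable_pi_apply k) hZ]
    rfl
  have hid : ∀ k, IdentDistrib (fun x => Z x k) f P P := fun k =>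
    ⟨(hZk k).aemeasurable, hf.aemeasurable, hlaw k⟩
  have hindep : iIndepFun (fun k x => Z x k) P := by
    rw [iIndepFun_iff_map_fun_eq_infinitePi_map hZk]
    simp only [hlaw]
    exact hZP
  refine ⟨fun k x => Z x k, fun k => ⟨hZk k, hlaw k⟩, ?_⟩
  have hlln := strong_law_Lp le_rfl ENNReal.one_ne_top (fun k x => Z x k)
    (memLp_one_iff_integrable.2 ((hid 0).integrable_iff.2 hfi))
    (fun i j hij => hindep.indepFun hij) (fun k => (hid k).trans (hid 0).symm)
  rwa [(hid 0).integral_eq] at hlln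

/-- Lemma 4.5: the function obtained from `f` by averaging it over `E` lies in the
`L¹` closure of the convex hull of the set of functions equidistributed with `f`. -/
theorem stmt0 {X : Type*} [MeasurableSpace X] (μ : Measure X) [IsFiniteMeasure μ]
    (hμ : Nonatomic μ) (f : X → ℝ) (hf : Measurable f) (hfi : Integrable f μ)
    (E : Set X) (hE : MeasurableSet E) (hEpos : 0 < μ E)
    (f' : X → ℝ)
    (hf' : ∀ x, f' x = if x ∈ E then ⨍ y in E, f y ∂μ else f x) :
    ∀ ε > 0, ∃ h ∈ convexHull ℝ
        {η : X → ℝ | Measurable η ∧ Measure.map η μ = Measure.map f μ},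
      ∫ x, |f' x - h x| ∂μ < ε := by
  intro ε hε
  have : IsProbabilityMeasure μ[|E] := cond_isProbabilityMeasure hEpos.ne'
  obtain ⟨u, hu, hu0⟩ := hμ.exists_measurable_preimage_singleton_null
  have hcond : ∀ g : X → ℝ, ∫ x, g x ∂μ[|E] = ⨍ x in E, g x ∂μ := fun g => by
    simp [average, ProbabilityTheory.cond]
  obtain ⟨Z, hZ, hlim⟩ := exists_seq_map_eq_tendsto_average hu
    (fun a => cond_absolutelyContinuous (hu0 a)) hf
    ((hfi.restrict (s := E)).smul_measure (ENNReal.inv_ne_top.2 hEpos.ne'))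
  let η : ℕ → X → ℝ := fun k x => if x ∈ E then Z k x else f x
  have hη : ∀ k, η k ∈ {η : X → ℝ | Measurable η ∧ Measure.map η μ = Measure.map f μ} := fun k =>
    ⟨Measurable.ite hE (hZ k).1 hf, map_ite_eq_of_map_cond_eq hE hEpos.ne' hf (hZ k).1 (hZ k).2⟩
  have hμE : 0 < μ.real E := ENNReal.toReal_pos hEpos.ne' (measure_ne_top μ E)
  obtain ⟨n, hn, hn0⟩ := ((hlim.eventually_lt_const
    (ENNReal.ofReal_pos.2 (div_pos hε hμE))).and (eventually_gt_atTop 0)).exists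
  have hn' : (n : ℝ) ≠ 0 := by positivity
  refine ⟨∑ k ∈ Finset.range n, (n : ℝ)⁻¹ • η k, ?_, ?_⟩
  · exact (convex_convexHull ℝ _).sum_mem (fun _ _ => by positivity) (by simp [hn'])
      fun k _ => subset_convexHull ℝ _ (hη k)
  set A : X → ℝ := fun x => (n : ℝ)⁻¹ • (∑ k ∈ Finset.range n, Z k x) - ∫ y, f y ∂μ[|E] with hA
  have hAm : Measurable A := by
    have := fun k => (hZ k).1
    fun_prop
  have hdiff : ∀ x, |f' x - (∑ k ∈ Finset.range n, (n : ℝ)⁻¹ • η k) x| = E.indicator (‖A ·‖) x := by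
    intro x
    rw [hf', Finset.sum_apply]
    by_cases hx : x ∈ E
    · simp [hx, η, hA, hcond, Finset.mul_sum, abs_sub_comm]
    · simp [hx, η, hn']
  have hbound : ∫ x, ‖A x‖ ∂μ[|E] < ε / μ.real E := by
    rw [integral_norm_eq_lintegral_enorm hAm.aestronglyMeasurable, ← eLpNorm_one_eq_lintegral_enorm]
    exact (ENNReal.lt_ofReal_iff_toReal_lt hn.ne_top).1 hn
  simp_rw [hdiff]
  rw [integral_indicator hE]
  rw [hcond, setAverage_eq, smul_eq_mul, inv_mul_eq_div, div_lt_div_iff_of_pos_right hμE] at hbound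
  exact hbound
end

section
/- Let (X, μ) be a finite nonatomic measure space, let φ₀ ∈ L¹(X, μ) be bounded below, and let ψ₀ ∈ L^∞(X, μ). Then sup{ ∫_X φ ψ₀ dμ : φ ∈ L¹(X, μ) equidistributed with φ₀ } = sup{ ∫_X φ₀ ψ dμ : ψ ∈ L^∞(X, μ) equidistributed with ψ₀ }, both suprema being finite real numbers. -/
open MeasureTheory

open Set Filter Topology in
/-- A nonatomic probability measure takes all values in `[0, 1]` along a single chain of sets. -/
theorem Nonatomic.exists_chain {X : Type*} [MeasurableSpace X] {μ : Measure X}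
    [IsProbabilityMeasure μ] (hμ : Nonatomic μ) :
    ∃ F : Set (Set X), (∀ A ∈ F, MeasurableSet A) ∧
      (∀ A ∈ F, ∀ B ∈ F, μ A ≤ μ B → A ⊆ B) ∧ ∀ t ≤ 1, ∃ A ∈ F, μ A = t := by
  let r : {s : Set X // MeasurableSet s} → {s : Set X // MeasurableSet s} → Prop :=
    fun A B => (A : Set X) ⊆ B ∧ μ A < μ B
  have hpair : IsChain r {⟨∅, .empty⟩, ⟨univ, .univ⟩} :=
    IsChain.pair ⟨empty_subset _, by simp⟩
  obtain ⟨F, hF, hpF⟩ := hpair.exists_maxChain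
  have hsub : ∀ A ∈ F, ∀ B ∈ F, μ A ≤ μ B → (A : Set X) ⊆ B := by
    intro A hA B hB h
    by_cases hAB : A = B
    · rw [hAB]
    · rcases hF.1 hA hB hAB with h' | h'
      · exact h'.1
      · exact absurd h'.2 h.not_gt
  have hmem : ∀ B, (∀ D ∈ F, r B D ∨ r D B) → B ∈ F := by
    intro B hB
    rw [hF.2 (hF.1.insert fun D hD _ => hB D hD) (subset_insert _ _)]
    exact mem_insert _ _
  let V : Set ENNReal := (fun A : {s : Set X // MeasurableSet s} => μ A) '' F
  have hsup : ∀ S ⊆ V, S.Nonempty → sSup S ∈ V := by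
    intro S hS hne
    obtain ⟨u, hu, hlim, huS⟩ := exists_seq_tendsto_sSup hne (OrderTop.bddAbove S)
    choose A hAF hA using fun n => hS (huS n)
    have hmono : Monotone fun n => (A n : Set X) := fun m n hmn =>
      hsub _ (hAF m) _ (hAF n) (by simpa only [hA] using hu hmn)
    have hval : sSup S = μ (⋃ n, (A n : Set X)) := by
      rw [hmono.measure_iUnion]
      refine tendsto_nhds_unique hlim ?_
      simp only [hA]
      exact tendsto_atTop_iSup hu
    by_contra hnot
    have hne' : ∀ D ∈ F, μ D ≠ μ (⋃ n, (A n : Set X)) := fun D hD h =>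
      hnot ⟨D, hD, h.trans hval.symm⟩
    refine hnot ⟨⟨_, .iUnion fun n => (A n).2⟩, hmem _ fun D hD => ?_, hval.symm⟩
    rcases (hne' D hD).lt_or_gt with h | h
    · refine .inr ⟨?_, h⟩
      rw [hmono.measure_iUnion, lt_iSup_iff] at h
      obtain ⟨n, hn⟩ := h
      exact (hsub _ hD _ (hAF n) hn.le).trans (subset_iUnion (fun n => (A n : Set X)) n)
    · exact .inl ⟨iUnion_subset fun n => hsub _ (hAF n) _ hD
        ((measure_mono (subset_iUnion (fun n => (A n : Set X)) n)).trans h.le), h⟩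
  have hinf : ∀ S ⊆ V, S.Nonempty → sInf S ∈ V := by
    intro S hS hne
    obtain ⟨u, hu, hlim, huS⟩ := exists_seq_tendsto_sInf hne (OrderBot.bddBelow S)
    choose A hAF hA using fun n => hS (huS n)
    have hmono : Antitone fun n => (A n : Set X) := fun m n hmn =>
      hsub _ (hAF n) _ (hAF m) (by simpa only [hA] using hu hmn)
    have hI : μ (⋂ n, (A n : Set X)) = ⨅ n, μ (A n : Set X) :=
      hmono.measure_iInter (fun n => (A n).2.nullMeasurableSet) ⟨0, measure_ne_top _ _⟩
    have hval : sInf S = μ (⋂ n, (A n : Set X)) := by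
      rw [hI]
      refine tendsto_nhds_unique hlim ?_
      simp only [hA]
      exact tendsto_atTop_iInf hu
    by_contra hnot
    have hne' : ∀ D ∈ F, μ D ≠ μ (⋂ n, (A n : Set X)) := fun D hD h =>
      hnot ⟨D, hD, h.trans hval.symm⟩
    refine hnot ⟨⟨_, .iInter fun n => (A n).2⟩, hmem _ fun D hD => ?_, hval.symm⟩
    rcases (hne' D hD).lt_or_gt with h | h
    · exact .inr ⟨subset_iInter fun n => hsub _ hD _ (hAF n)
        (h.le.trans (measure_mono (iInter_subset (fun n => (A n : Set X)) n))), h⟩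
    · refine .inl ⟨?_, h⟩
      rw [hI, iInf_lt_iff] at h
      obtain ⟨n, hn⟩ := h
      exact (iInter_subset (fun n => (A n : Set X)) n).trans (hsub _ (hAF n) _ hD hn.le)
  refine ⟨Subtype.val '' F, ?_, ?_, fun t ht => ?_⟩
  · rintro _ ⟨A, -, rfl⟩
    exact A.2
  · rintro _ ⟨A, hA, rfl⟩ _ ⟨B, hB, rfl⟩
    exact hsub A hA B hB
  by_contra hnot
  have hnot' : ∀ D ∈ F, μ D ≠ t := fun D hD h => hnot ⟨D, ⟨D, hD, rfl⟩, h⟩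
  obtain ⟨B, hBF, hB⟩ := hsup {v ∈ V | v ≤ t} (fun _ h => h.1)
    ⟨0, ⟨_, hpF (mem_insert _ _), measure_empty⟩, zero_le⟩
  obtain ⟨B', hBF', hB'⟩ := hinf {v ∈ V | t ≤ v} (fun _ h => h.1)
    ⟨1, ⟨_, hpF (mem_insert_of_mem _ rfl), measure_univ⟩, ht⟩
  have hlow : ∀ D ∈ F, μ D ≤ t → μ D ≤ μ B := fun D hD h => by
    refine le_of_le_of_eq (le_sSup ?_) hB.symm
    exact ⟨⟨D, hD, rfl⟩, h⟩
  have hhigh : ∀ D ∈ F, t ≤ μ D → μ B' ≤ μ D := fun D hD h => by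
    refine le_of_eq_of_le hB' (sInf_le ?_)
    exact ⟨⟨D, hD, rfl⟩, h⟩
  have hBt : μ B < t := lt_of_le_of_ne (hB.le.trans (sSup_le fun _ h => h.2)) (hnot' B hBF)
  have htB : t < μ B' :=
    lt_of_le_of_ne ((le_sInf fun _ h => h.2).trans hB'.ge) (hnot' B' hBF').symm
  have hBB : (B : Set X) ⊆ B' := hsub B hBF B' hBF' (hBt.trans htB).le
  have hdiff : μ ((B' : Set X) \ B) = μ B' - μ B :=
    measure_sdiff hBB B.2.nullMeasurableSet (measure_ne_top _ _)
  obtain ⟨T, hTsub, hTm, hT0, hT1⟩ := hμ ((B' : Set X) \ B) (B'.2.diff B.2)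
    (by rw [hdiff]; exact tsub_pos_of_lt (hBt.trans htB))
  have hμU : μ ((B : Set X) ∪ T) = μ B + μ T :=
    measure_union (disjoint_sdiff_right.mono_right hTsub) hTm
  have hlt1 : μ B < μ ((B : Set X) ∪ T) := by
    rw [hμU]
    exact ENNReal.lt_add_right (measure_ne_top _ _) hT0.ne'
  have hlt2 : μ ((B : Set X) ∪ T) < μ B' := by
    rw [hμU, add_comm]
    rw [hdiff] at hT1
    exact lt_tsub_iff_right.mp hT1
  have hUF : (⟨(B : Set X) ∪ T, B.2.union hTm⟩ : {s : Set X // MeasurableSet s}) ∈ F := by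
    refine hmem _ fun D hD => ?_
    rcases (hnot' D hD).lt_or_gt with h | h
    · have h' := hlow D hD h.le
      exact .inr ⟨(hsub D hD B hBF h').trans subset_union_left, h'.trans_lt hlt1⟩
    · have h' := hhigh D hD h.le
      exact .inl ⟨(union_subset hBB (hTsub.trans sdiff_subset)).trans (hsub B' hBF' D hD h'),
        hlt2.trans_le h'⟩
  rcases le_total (μ ((B : Set X) ∪ T)) t with h | h
  · exact (hlow _ hUF h).not_gt hlt1
  · exact (hhigh _ hUF h).not_gt hlt2

open Set unitInterval in
/-- A nonatomic probability space carries a uniformly distributed function. -/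
theorem Nonatomic.exists_map_eq_volume {X : Type*} [MeasurableSpace X] {μ : Measure X}
    [IsProbabilityMeasure μ] (hμ : Nonatomic μ) :
    ∃ U : X → I, Measurable U ∧ μ.map U = volume := by
  obtain ⟨F, hFm, hFsub, hF⟩ := hμ.exists_chain
  choose A hAF hA using fun t : I =>
    hF (ENNReal.ofReal t) (by simpa using t.2.2)
  have hmono : ∀ s t : I, s ≤ t → A s ⊆ A t := fun s t hst =>
    hFsub _ (hAF s) _ (hAF t) (by rw [hA, hA]; exact ENNReal.ofReal_le_ofReal hst)
  let ι := {q : ℚ // (q : ℝ) ∈ I}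
  let e : ι → I := fun q => ⟨q.1, q.2⟩
  classical
  let U : X → I := fun x => ⨅ q : ι, if x ∈ A (e q) then e q else 1
  have hU : Measurable U := Measurable.iInf fun q =>
    Measurable.ite (hFm _ (hAF _)) measurable_const measurable_const
  have hpre : ∀ t : I, U ⁻¹' Iio t = ⋃ q : {q : ι // e q < t}, A (e q) := by
    intro t
    ext x
    simp only [U, mem_preimage, mem_Iio, iInf_lt_iff, mem_iUnion, Subtype.exists, exists_prop]
    refine exists_congr fun q => ?_
    split_ifs with h
    · simp [h]
    · simp [h, unitInterval.le_one']
  have hIio : ∀ t : I, μ (U ⁻¹' Iio t) = ENNReal.ofReal t := by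
    intro t
    rw [hpre]
    apply le_antisymm
    · rw [← hA t]
      exact measure_mono (iUnion_subset fun q => hmono _ _ q.2.le)
    · refine le_of_forall_lt fun c hc => ?_
      have hcr : c.toReal < t := (ENNReal.lt_ofReal_iff_toReal_lt hc.ne_top).mp hc
      obtain ⟨q, hq1, hq2⟩ := exists_rat_btwn hcr
      have hqI : (q : ℝ) ∈ I := ⟨ENNReal.toReal_nonneg.trans hq1.le, hq2.le.trans t.2.2⟩
      calc c < ENNReal.ofReal q := (ENNReal.lt_ofReal_iff_toReal_lt hc.ne_top).mpr hq1
        _ = μ (A (e ⟨q, hqI⟩)) := (hA (e ⟨q, hqI⟩)).symm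
        _ ≤ _ := measure_mono
          (subset_iUnion (fun q : {q : ι // e q < t} => A (e q)) ⟨⟨q, hqI⟩, hq2⟩)
  refine ⟨U, hU, ?_⟩
  have := Measure.isProbabilityMeasure_map (μ := μ) hU.aemeasurable
  refine Measure.ext_of_Ici _ _ fun t => ?_
  rw [← compl_Iio, prob_compl_eq_one_sub measurableSet_Iio,
    prob_compl_eq_one_sub measurableSet_Iio, Measure.map_apply hU measurableSet_Iio, hIio,
    volume_Iio]

theorem Nonatomic.restrict {X : Type*} [MeasurableSpace X] {μ : Measure X}
    (hμ : Nonatomic μ) {E : Set X} (hE : MeasurableSet E) : Nonatomic (μ.restrict E) := by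
  intro s hs h
  rw [Measure.restrict_apply hs] at h
  obtain ⟨t, hts, ht, h0, h1⟩ := hμ (s ∩ E) (hs.inter hE) h
  refine ⟨t, hts.trans Set.inter_subset_left, ht, ?_⟩
  rw [Measure.restrict_apply hs, Measure.restrict_apply ht,
    Set.inter_eq_left.mpr (hts.trans Set.inter_subset_right)]
  exact ⟨h0, h1⟩

/-- On a finite nonatomic measure space, every Borel measure on `ℝ` of the same total mass is the
distribution of a measurable function. -/
theorem Nonatomic.exists_map_eq {X : Type*} [MeasurableSpace X] {μ : Measure X}
    [IsFiniteMeasure μ] (hμ : Nonatomic μ) (ν : Measure ℝ) (hν : ν Set.univ = μ Set.univ) :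
    ∃ h : X → ℝ, Measurable h ∧ μ.map h = ν := by
  by_cases h0 : μ Set.univ = 0
  · refine ⟨0, measurable_zero, ?_⟩
    rw [Measure.measure_univ_eq_zero.mp h0, Measure.map_zero,
      Measure.measure_univ_eq_zero.mp (hν.trans h0)]
  have htop := measure_ne_top μ Set.univ
  set c := (μ Set.univ)⁻¹ with hc
  have hc0 : c ≠ 0 := ENNReal.inv_ne_zero.mpr htop
  have hct : c ≠ ⊤ := ENNReal.inv_ne_top.mpr h0
  have : IsProbabilityMeasure (c • μ) := ⟨by
    rw [Measure.smul_apply, smul_eq_mul, hc, ENNReal.inv_mul_cancel h0 htop]⟩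
  have : IsProbabilityMeasure (c • ν) := ⟨by
    rw [Measure.smul_apply, smul_eq_mul, hν, hc, ENNReal.inv_mul_cancel h0 htop]⟩
  have hna : Nonatomic (c • μ) := by
    intro s hs h
    simp only [Measure.smul_apply, smul_eq_mul] at h ⊢
    obtain ⟨t, hts, ht, ht0, ht1⟩ := hμ s hs (pos_of_ne_zero fun h' => by simp [h'] at h)
    exact ⟨t, hts, ht, ENNReal.mul_pos hc0 ht0.ne',
      (ENNReal.mul_lt_mul_iff_right hc0 hct).mpr ht1⟩
  obtain ⟨U, hU, hUmap⟩ := hna.exists_map_eq_volume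
  obtain ⟨f, hf, hfmap⟩ := Measure.exists_measurable_map_eq (c • ν)
  refine ⟨f ∘ U, hf.comp hU, ?_⟩
  have key : c • μ.map (f ∘ U) = c • ν := by
    rw [← Measure.map_smul, ← Measure.map_map hf hU, hUmap, hfmap]
  ext s hs
  have := congrArg (fun m => m s) key
  simpa only [Measure.smul_apply, smul_eq_mul, ENNReal.mul_right_inj hc0 hct] using this

open Set in
/-- If `k` and `k'` are equidistributed with countable range, then every pair `(k, g)` has the same
joint distribution as some pair `(k', g')`. -/
theorem Nonatomic.exists_map_prodMk_eq {X : Type*} [MeasurableSpace X] {μ : Measure X}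
    [IsFiniteMeasure μ] (hμ : Nonatomic μ) {k k' : X → ℤ} (hk : Measurable k)
    (hk' : Measurable k') (hkk' : μ.map k = μ.map k') {g : X → ℝ} (hg : Measurable g) :
    ∃ g' : X → ℝ, Measurable g' ∧
      μ.map (fun x => (k' x, g' x)) = μ.map (fun x => (k x, g x)) := by
  have hmass : ∀ n, ((μ.restrict (k ⁻¹' {n})).map g) univ = (μ.restrict (k' ⁻¹' {n})) univ := by
    intro n
    rw [Measure.map_apply hg .univ, preimage_univ, Measure.restrict_apply_univ,
      Measure.restrict_apply_univ, ← Measure.map_apply hk (measurableSet_singleton n), hkk',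
      Measure.map_apply hk' (measurableSet_singleton n)]
  choose h hh hmap using fun n =>
    (hμ.restrict (hk' (measurableSet_singleton n))).exists_map_eq _ (hmass n)
  have hg' : Measurable fun x => h (k' x) x :=
    (measurable_from_prod_countable_right (f := fun p : ℤ × X => h p.1 p.2) hh).comp
      (hk'.prodMk measurable_id)
  refine ⟨fun x => h (k' x) x, hg', ?_⟩
  have hdecomp : ∀ (j : X → ℤ) (f : X → ℝ), Measurable j → Measurable f →
      ∀ s : Set (ℤ × ℝ), MeasurableSet s → μ.map (fun x => (j x, f x)) s =
        ∑' n, (μ.restrict (j ⁻¹' {n})) (f ⁻¹' (Prod.mk n ⁻¹' s)) := by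
    intro j f hj hf s hs
    have hn : ∀ n, MeasurableSet (f ⁻¹' (Prod.mk n ⁻¹' s)) := fun n =>
      hf (measurable_prodMk_left hs)
    have hset : (fun x => (j x, f x)) ⁻¹' s =
        ⋃ n, f ⁻¹' (Prod.mk n ⁻¹' s) ∩ j ⁻¹' {n} := by
      ext x
      simp
    rw [Measure.map_apply (hj.prodMk hf) hs, hset, measure_iUnion]
    · exact tsum_congr fun n => (Measure.restrict_apply (hn n)).symm
    · intro m n hmn
      exact ((disjoint_singleton.mpr hmn).preimage j).mono inter_subset_right inter_subset_right
    · exact fun n => (hn n).inter (hj (measurableSet_singleton n))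
  ext s hs
  rw [hdecomp _ _ hk' hg' s hs, hdecomp _ _ hk hg s hs]
  refine tsum_congr fun n => ?_
  have hsn : MeasurableSet (Prod.mk n ⁻¹' s : Set ℝ) := measurable_prodMk_left hs
  rw [← Measure.map_apply hg hsn, ← hmap n, Measure.map_apply (hh n) hsn,
    Measure.restrict_apply (hg' hsn), Measure.restrict_apply (hh n hsn)]
  congr 1
  ext x
  simp only [mem_inter_iff, mem_preimage, mem_singleton_iff]
  constructor <;> (rintro ⟨h1, rfl⟩; exact ⟨h1, rfl⟩)

open ProbabilityTheory in
/-- If `f` and `f'` are equidistributed, then `∫ f g` is matched up to `ε` by `∫ f' g'` for some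
rearrangement `g'` of `g`. -/
theorem Nonatomic.exists_integral_mul_le {X : Type*} [MeasurableSpace X] {μ : Measure X}
    [IsFiniteMeasure μ] (hμ : Nonatomic μ) {f f' g : X → ℝ} (hf : Measurable f)
    (hf' : Measurable f') (hff' : μ.map f = μ.map f') (hg : Measurable g)
    (hgi : Integrable g μ) (hfg : Integrable (fun x => f x * g x) μ) {ε : ℝ} (hε : 0 < ε) :
    ∃ g' : X → ℝ, Measurable g' ∧ μ.map g' = μ.map g ∧
      ∫ x, f x * g x ∂μ ≤ ∫ x, f' x * g' x ∂μ + ε := by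
  set M := ∫ x, |g x| ∂μ with hM
  have hM0 : 0 ≤ M := integral_nonneg fun _ => abs_nonneg _
  obtain ⟨δ, hδ, hδε⟩ : ∃ δ > 0, 2 * (δ * M) ≤ ε := by
    refine ⟨ε / (2 * (M + 1)), by positivity, ?_⟩
    have : 2 * (ε / (2 * (M + 1)) * M) = ε * (M / (M + 1)) := by field_simp
    rw [this]
    exact mul_le_of_le_one_right hε.le (div_le_one_of_le₀ (by linarith) (by linarith))
  let q : ℝ → ℤ := fun y => ⌊y / δ⌋
  have hq : Measurable q := Int.measurable_floor.comp (measurable_id.div_const δ)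
  have hqδ : ∀ y z : ℝ, |y * z - δ * q y * z| ≤ δ * |z| := by
    intro y z
    have h1 : δ * q y ≤ y := by
      rw [mul_comm, ← le_div_iff₀ hδ]
      exact Int.floor_le _
    have h2 : y ≤ δ * q y + δ := by
      have := (Int.lt_floor_add_one (y / δ)).le
      rw [div_le_iff₀ hδ] at this
      linarith [show ((q y : ℝ) + 1) * δ = δ * q y + δ by ring]
    rw [← sub_mul, abs_mul]
    exact mul_le_mul_of_nonneg_right (abs_le.mpr ⟨by linarith, by linarith⟩) (abs_nonneg z)
  obtain ⟨g', hg', hjoint⟩ := hμ.exists_map_prodMk_eq (hq.comp hf) (hq.comp hf')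
    (by rw [← Measure.map_map hq hf, ← Measure.map_map hq hf', hff']) hg
  have hid : IdentDistrib (fun x => (q (f' x), g' x)) (fun x => (q (f x), g x)) μ μ :=
    ⟨((hq.comp hf').prodMk hg').aemeasurable, ((hq.comp hf).prodMk hg).aemeasurable, hjoint⟩
  have hidg : IdentDistrib g' g μ μ := hid.comp measurable_snd
  have hidm : IdentDistrib (fun x => δ * q (f' x) * g' x) (fun x => δ * q (f x) * g x) μ μ :=
    hid.comp (u := fun p : ℤ × ℝ => δ * p.1 * p.2) (by fun_prop)
  have hgi' : Integrable g' μ := hidg.integrable_iff.mpr hgi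
  have hMg' : ∫ x, |g' x| ∂μ = M := (hidg.comp measurable_norm).integral_eq
  have hbd : ∀ {u v : X → ℝ}, Measurable u → Measurable v → Integrable v μ →
      Integrable (fun x => u x * v x - δ * q (u x) * v x) μ := fun {u v} hu hv hvi =>
    (hvi.abs.const_mul δ).mono'
      ((hu.mul hv).sub ((((measurable_of_countable fun n : ℤ => (n : ℝ)).comp
        (hq.comp hu)).const_mul δ).mul hv)).aestronglyMeasurable
      (ae_of_all _ fun x => hqδ (u x) (v x))
  have hsg : Integrable (fun x => δ * q (f x) * g x) μ :=
    (hfg.sub (hbd hf hg hgi)).congr (ae_of_all _ fun x => by simp)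
  have hsg' : Integrable (fun x => δ * q (f' x) * g' x) μ := hidm.integrable_iff.mpr hsg
  have hfg' : Integrable (fun x => f' x * g' x) μ :=
    ((hbd hf' hg' hgi').add hsg').congr (ae_of_all _ fun x => by simp)
  refine ⟨g', hg', hidg.map_eq, ?_⟩
  have e1 : ∫ x, f x * g x ∂μ ≤ ∫ x, δ * q (f x) * g x ∂μ + δ * M := by
    rw [hM, ← integral_const_mul, ← integral_add hsg (hgi.abs.const_mul δ)]
    refine integral_mono hfg (hsg.add (hgi.abs.const_mul δ)) fun x => ?_
    have := (abs_le.mp (hqδ (f x) (g x))).2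
    simp only [] at *
    linarith
  have e2 : ∫ x, δ * q (f' x) * g' x ∂μ ≤ ∫ x, f' x * g' x ∂μ + δ * M := by
    rw [← hMg', ← integral_const_mul, ← integral_add hfg' (hgi'.abs.const_mul δ)]
    refine integral_mono hsg' (hfg'.add (hgi'.abs.const_mul δ)) fun x => ?_
    have := (abs_le.mp (hqδ (f' x) (g' x))).1
    simp only [] at *
    linarith
  have e3 := hidm.integral_eq
  linarith

/-- Lemma 7.2(a): for `φ₀ ∈ L¹` bounded below and `ψ₀ ∈ L^∞`,
`sup_{φ ∼ φ₀} ∫ φ ψ₀ = sup_{ψ ∼ ψ₀} ∫ φ₀ ψ`, both suprema being finite. -/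
theorem stmt10 {X : Type*} [MeasurableSpace X] (μ : Measure X) [IsFiniteMeasure μ]
    (hμ : Nonatomic μ)
    (φ₀ : X → ℝ) (hφm : Measurable φ₀) (hφi : Integrable φ₀ μ)
    (c : ℝ) (hφbdd : ∀ x, c ≤ φ₀ x)
    (ψ₀ : X → ℝ) (hψm : Measurable ψ₀) (C : ℝ) (hψb : ∀ x, |ψ₀ x| ≤ C) :
    (let A : Set ℝ := {r : ℝ | ∃ φ : X → ℝ, Measurable φ ∧
        Measure.map φ μ = Measure.map φ₀ μ ∧ r = ∫ x, φ x * ψ₀ x ∂μ};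
     let B : Set ℝ := {r : ℝ | ∃ ψ : X → ℝ, Measurable ψ ∧
        Measure.map ψ μ = Measure.map ψ₀ μ ∧ r = ∫ x, φ₀ x * ψ x ∂μ};
     A.Nonempty ∧ B.Nonempty ∧ BddAbove A ∧ BddAbove B ∧ sSup A = sSup B) := by
  intro A B
  have hid : ∀ {u v : X → ℝ}, Measurable u → Measurable v → μ.map u = μ.map v →
      ProbabilityTheory.IdentDistrib u v μ μ := fun hu hv h =>
    ⟨hu.aemeasurable, hv.aemeasurable, h⟩
  have hψi : Integrable ψ₀ μ :=
    .of_bound hψm.aestronglyMeasurable C (ae_of_all _ hψb)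
  have hA : ∀ φ : X → ℝ, Measurable φ → μ.map φ = μ.map φ₀ → Integrable φ μ :=
    fun φ hφ h => (hid hφ hφm h).integrable_iff.mpr hφi
  have hψC : ∀ ψ : X → ℝ, Measurable ψ → μ.map ψ = μ.map ψ₀ → ∀ᵐ x ∂μ, ‖ψ x‖ ≤ C :=
    fun ψ hψ h => (hid hψm hψ h.symm).ae_snd (p := fun y => ‖y‖ ≤ C)
      (measurableSet_le measurable_norm measurable_const) (ae_of_all _ hψb)
  have hAB : ∀ a ∈ A, ∀ ε > 0, ∃ b ∈ B, a ≤ b + ε := by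
    rintro _ ⟨φ, hφ, hmap, rfl⟩ ε hε
    obtain ⟨ψ, hψ, hψmap, hle⟩ := hμ.exists_integral_mul_le hφ hφm hmap hψm hψi
      ((hA φ hφ hmap).mul_bdd hψm.aestronglyMeasurable (ae_of_all _ hψb)) hε
    exact ⟨_, ⟨ψ, hψ, hψmap, rfl⟩, hle⟩
  have hBA : ∀ b ∈ B, ∀ ε > 0, ∃ a ∈ A, b ≤ a + ε := by
    rintro _ ⟨ψ, hψ, hmap, rfl⟩ ε hε
    obtain ⟨φ, hφ, hφmap, hle⟩ := hμ.exists_integral_mul_le hψ hψm hmap hφm hφi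
      (hφi.bdd_mul hψ.aestronglyMeasurable (hψC ψ hψ hmap)) hε
    simp only [mul_comm (ψ _), mul_comm (ψ₀ _)] at hle
    exact ⟨_, ⟨φ, hφ, hφmap, rfl⟩, hle⟩
  have hAne : A.Nonempty := ⟨_, φ₀, hφm, rfl, rfl⟩
  have hBne : B.Nonempty := ⟨_, ψ₀, hψm, rfl, rfl⟩
  have hAbdd : BddAbove A := by
    refine ⟨(∫ x, |φ₀ x| ∂μ) * C, ?_⟩
    rintro _ ⟨φ, hφ, hmap, rfl⟩
    have hφi' := hA φ hφ hmap
    have : ∫ x, |φ x| ∂μ = ∫ x, |φ₀ x| ∂μ :=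
      ((hid hφ hφm hmap).comp measurable_norm).integral_eq
    rw [← this, ← integral_mul_const]
    refine integral_mono (hφi'.mul_bdd hψm.aestronglyMeasurable (ae_of_all _ hψb))
      (hφi'.abs.mul_const C) fun x => ?_
    calc φ x * ψ₀ x ≤ |φ x| * |ψ₀ x| := (le_abs_self _).trans (abs_mul _ _).le
      _ ≤ |φ x| * C := mul_le_mul_of_nonneg_left (hψb x) (abs_nonneg _)
  have hBbdd : BddAbove B := by
    refine ⟨sSup A + 1, fun b hb => ?_⟩
    obtain ⟨a, ha, hle⟩ := hBA b hb 1 one_pos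
    linarith [le_csSup hAbdd ha]
  refine ⟨hAne, hBne, hAbdd, hBbdd, le_antisymm ?_ ?_⟩
  · refine csSup_le hAne fun a ha => le_of_forall_pos_le_add fun ε hε => ?_
    obtain ⟨b, hb, hle⟩ := hAB a ha ε hε
    linarith [le_csSup hBbdd hb]
  · refine csSup_le hBne fun b hb => le_of_forall_pos_le_add fun ε hε => ?_
    obtain ⟨a, ha, hle⟩ := hBA b hb ε hε
    linarith [le_csSup hAbdd ha]
end

section
/- Let (X, μ) be a finite nonatomic measure space and let φ₀, ψ ∈ L^∞(X, μ). Then sup{ ∫_X |φ| ψ dμ : φ equidistributed with φ₀ } ≤ sup{ ∫_X φ ψ dμ : φ equidistributed with φ₀ } + sup{ ∫_X (−φ) ψ dμ : φ equidistributed with φ₀ } + (⨍_X |φ₀| dμ) ∫_X ψ dμ. -/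
open MeasureTheory

section

open Filter Topology Set

/-- In a finite nonatomic measure space, sets of positive measure have measurable subsets of
arbitrarily small positive measure. -/
lemma Nonatomic.exists_subset_measure_le {X : Type*} [MeasurableSpace X] {μ : Measure X}
    [IsFiniteMeasure μ] (hμ : Nonatomic μ) {s : Set X} (hs : MeasurableSet s) (hs0 : 0 < μ s)
    {δ : ENNReal} (hδ : δ ≠ 0) :
    ∃ t, t ⊆ s ∧ MeasurableSet t ∧ 0 < μ t ∧ μ t ≤ δ := by
  have key : ∀ n : ℕ, ∃ t, t ⊆ s ∧ MeasurableSet t ∧ 0 < μ t ∧ 2 ^ n * μ t ≤ μ s := by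
    intro n
    induction n with
    | zero => exact ⟨s, subset_rfl, hs, hs0, by simp⟩
    | succ n ih =>
      obtain ⟨t, hts, ht, ht0, htn⟩ := ih
      obtain ⟨u, hut, hu, hu0, hlt⟩ := hμ t ht ht0
      have hsplit : μ u + μ (t \ u) = μ t := by
        rw [measure_sdiff hut hu.nullMeasurableSet (measure_ne_top _ _)]
        exact add_tsub_cancel_of_le hlt.le
      rcases le_total (μ u) (μ (t \ u)) with h | h
      · refine ⟨u, hut.trans hts, hu, hu0, ?_⟩
        calc 2 ^ (n + 1) * μ u = 2 ^ n * (μ u + μ u) := by ring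
          _ ≤ 2 ^ n * μ t := by rw [← hsplit]; gcongr
          _ ≤ μ s := htn
      · refine ⟨t \ u, sdiff_subset.trans hts, ht.diff hu, ?_, ?_⟩
        · refine pos_iff_ne_zero.2 fun h0 => ?_
          rw [h0, add_zero] at hsplit
          exact hlt.ne hsplit
        · calc 2 ^ (n + 1) * μ (t \ u) = 2 ^ n * (μ (t \ u) + μ (t \ u)) := by ring
            _ ≤ 2 ^ n * μ t := by rw [← hsplit]; gcongr
            _ ≤ μ s := htn
  obtain ⟨n, hn0, hn⟩ := ENNReal.exists_nat_pos_mul_gt hδ (measure_ne_top μ s)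
  obtain ⟨t, hts, ht, ht0, htn⟩ := key n
  refine ⟨t, hts, ht, ht0, ?_⟩
  by_contra! hlt
  have h2 : (n : ENNReal) ≤ 2 ^ n := by exact_mod_cast n.lt_two_pow_self.le
  have : (n : ENNReal) * δ ≤ μ s :=
    (mul_le_mul' h2 hlt.le).trans htn
  exact absurd hn (not_lt.2 this)

/-- A finite nonatomic measure space is covered by countably many measurable sets of measure at
most `δ`. -/
lemma Nonatomic.exists_countable_cover_s13 {X : Type*} [MeasurableSpace X] {μ : Measure X}
    [IsFiniteMeasure μ] (hμ : Nonatomic μ) {δ : ENNReal} (hδ : δ ≠ 0) :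
    ∃ F : Set (Set X), F.Countable ∧ (∀ A ∈ F, MeasurableSet A ∧ μ A ≤ δ) ∧ ⋃₀ F = univ := by
  obtain ⟨F, hF⟩ := zorn_subset
    {F : Set (Set X) | (∀ A ∈ F, MeasurableSet A ∧ 0 < μ A ∧ μ A ≤ δ) ∧ F.PairwiseDisjoint id}
    (by
      intro c hc hchain
      refine ⟨⋃₀ c, ⟨?_, ?_⟩, fun s hs => subset_sUnion_of_mem hs⟩
      · rintro A ⟨F, hFc, hA⟩
        exact (hc hFc).1 A hA
      · exact (pairwiseDisjoint_sUnion hchain.directedOn).2 fun F hFc => (hc hFc).2)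
  obtain ⟨hF1, hF2⟩ := hF.prop
  have hcount : F.Countable := by
    have h := Measure.countable_meas_pos_of_disjoint_iUnion (μ := μ) (As := fun A : F => (A : Set X))
      (fun A => (hF1 A A.2).1) (fun A B hAB => hF2 A.2 B.2 (Subtype.coe_injective.ne hAB))
    have : {A : F | 0 < μ (A : Set X)} = univ := eq_univ_of_forall fun A => (hF1 A A.2).2.1
    rw [this] at h
    exact countable_coe_iff.1 (countable_univ_iff.1 h)
  have hUm : MeasurableSet (⋃₀ F) := MeasurableSet.sUnion hcount fun A hA => (hF1 A hA).1
  have hnull : μ (⋃₀ F)ᶜ = 0 := by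
    by_contra h0
    obtain ⟨t, hts, ht, ht0, htδ⟩ :=
      hμ.exists_subset_measure_le hUm.compl (pos_iff_ne_zero.2 h0) hδ
    have hins : insert t F ⊆ F := by
      refine hF.le_of_ge ⟨?_, ?_⟩ (subset_insert t F)
      · rintro A (rfl | hA)
        · exact ⟨ht, ht0, htδ⟩
        · exact hF1 A hA
      · refine hF2.insert fun A hA _ => ?_
        exact disjoint_left.2 fun x hx hxA => hts hx ⟨A, hA, hxA⟩
    have htF : t ∈ F := hins (mem_insert t F)
    have : t = ∅ := eq_empty_of_forall_notMem fun x hx => hts hx ⟨t, htF, hx⟩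
    simp [this] at ht0
  refine ⟨insert (⋃₀ F)ᶜ F, hcount.insert _, ?_, ?_⟩
  · rintro A (rfl | hA)
    · exact ⟨hUm.compl, by simp [hnull]⟩
    · exact ⟨(hF1 A hA).1, (hF1 A hA).2.2⟩
  · rw [sUnion_insert, compl_union_self]

/-- A finite nonatomic measure space carries a measurable function into `[0, 1)` all of whose
level sets are null. -/
lemma Nonatomic.exists_measurable_level_null {X : Type*} [MeasurableSpace X] {μ : Measure X}
    [IsFiniteMeasure μ] (hμ : Nonatomic μ) :
    ∃ V : X → ℝ, Measurable V ∧ (∀ x, 0 ≤ V x ∧ V x < 1) ∧ ∀ c, μ {x | V x = c} = 0 := by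
  classical
  choose F hFc hF hFU using fun n : ℕ =>
    hμ.exists_countable_cover_s13 (δ := ((n : ENNReal) + 1)⁻¹) (by simp)
  have hcount : (⋃ n, F n).Countable := countable_iUnion hFc
  obtain ⟨A, hA⟩ : ∃ A : ℕ → Set X, (⋃ n, F n) ∪ {∅} = range A :=
    (hcount.union (countable_singleton ∅)).exists_eq_range ⟨∅, by simp⟩
  have hAm : ∀ n, MeasurableSet (A n) := by
    intro n
    have : A n ∈ (⋃ n, F n) ∪ {∅} := hA ▸ mem_range_self n
    rcases this with h | h
    · obtain ⟨k, hk⟩ := mem_iUnion.1 h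
      exact (hF k _ hk).1
    · rw [mem_singleton_iff.1 h]; exact MeasurableSet.empty
  let d : X → ℕ → Bool := fun x n => decide (x ∈ A n)
  let W : X → ℝ := fun x => Cardinal.cantorFunction (1 / 3) (d x)
  have hW0 : ∀ x, 0 ≤ W x := fun x =>
    tsum_nonneg fun n => Cardinal.cantorFunctionAux_nonneg (by norm_num)
  have hW1 : ∀ x, W x ≤ 3 / 2 := by
    intro x
    have h := Cardinal.cantorFunction_le (c := 1 / 3) (f := d x) (g := fun _ => true)
      (by norm_num) (by norm_num) (fun _ _ => rfl)
    refine h.trans (le_of_eq ?_)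
    simp only [Cardinal.cantorFunction, Cardinal.cantorFunctionAux, cond_true]
    rw [tsum_geometric_of_lt_one (by norm_num) (by norm_num)]
    norm_num
  have hWm : Measurable W := by
    refine measurable_of_tendsto_metrizable
      (f := fun N x => ∑ n ∈ Finset.range N, Cardinal.cantorFunctionAux (1 / 3) (d x) n)
      (fun N => ?_) (tendsto_pi_nhds.2 fun x => ?_)
    · refine Finset.measurable_fun_sum _ fun n _ => ?_
      have : (fun x => Cardinal.cantorFunctionAux (1 / 3) (d x) n)
          = (A n).indicator fun _ => (1 / 3 : ℝ) ^ n := by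
        ext x
        by_cases hx : x ∈ A n <;> simp [Cardinal.cantorFunctionAux, d, hx]
      rw [this]
      exact measurable_const.indicator (hAm n)
    · exact (Cardinal.summable_cantor_function (d x) (by norm_num)
        (by norm_num)).hasSum.tendsto_sum_nat
  have hWnull : ∀ c, μ {x | W x = c} = 0 := by
    intro c
    rcases eq_empty_or_nonempty {x | W x = c} with h | ⟨x, hx⟩
    · rw [h, measure_empty]
    have hle : ∀ n : ℕ, μ {x | W x = c} ≤ ((n : ENNReal) + 1)⁻¹ := by
      intro n
      obtain ⟨B, hB, hxB⟩ : x ∈ ⋃₀ F n := hFU n ▸ mem_univ x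
      obtain ⟨m, rfl⟩ : B ∈ range A := hA ▸ Or.inl (mem_iUnion.2 ⟨n, hB⟩)
      refine (measure_mono fun y hy => ?_).trans (hF n _ hB).2
      have hxy : d y = d x := Cardinal.cantorFunction_injective (by norm_num) (by norm_num)
        (Eq.trans (b := c) hy hx.symm)
      have := congrFun hxy m
      simpa [d, hxB] using this
    by_contra h0
    obtain ⟨n, hn⟩ := ENNReal.exists_inv_nat_lt h0
    refine absurd ((hle n).trans_lt ?_) (lt_irrefl _)
    exact (ENNReal.inv_le_inv.2 le_self_add).trans_lt hn
  refine ⟨fun x => W x / 2, hWm.div_const 2, fun x => ⟨by have := hW0 x; positivity, ?_⟩,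
    fun c => ?_⟩
  · have := hW1 x
    linarith
  · convert! hWnull (2 * c) using 4
    constructor <;> intro h <;> linarith

/-- Every measurable real function on a finite nonatomic measure space is a uniform limit of
measurable functions with null level sets. -/
lemma Nonatomic.exists_close_level_null {X : Type*} [MeasurableSpace X] {μ : Measure X}
    [IsFiniteMeasure μ] (hμ : Nonatomic μ) {ψ : X → ℝ} (hψ : Measurable ψ) {δ : ℝ} (hδ : 0 < δ) :
    ∃ g : X → ℝ, Measurable g ∧ (∀ x, |ψ x - g x| ≤ δ) ∧ ∀ c, μ {x | g x = c} = 0 := by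
  obtain ⟨V, hVm, hV, hVnull⟩ := hμ.exists_measurable_level_null
  refine ⟨fun x => δ * (⌊ψ x / δ⌋ + V x), ?_, fun x => ?_, fun c => ?_⟩
  · have : Measurable fun x => ((⌊ψ x / δ⌋ : ℤ) : ℝ) :=
      (measurable_of_countable _).comp (hψ.div_const δ).floor
    exact (this.add hVm).const_mul δ
  · have h1 := Int.floor_le (ψ x / δ)
    have h2 := Int.lt_floor_add_one (ψ x / δ)
    have h3 : ψ x = δ * (ψ x / δ) := by field_simp
    have h4 := hV x
    calc |ψ x - δ * (⌊ψ x / δ⌋ + V x)| = δ * |ψ x / δ - (⌊ψ x / δ⌋ + V x)| := by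
          rw [← abs_of_pos hδ, ← abs_mul, abs_of_pos hδ, mul_sub, ← h3]
      _ ≤ δ * 1 := by
          gcongr
          rw [abs_le]
          constructor <;> linarith
      _ = δ := mul_one δ
  · refine measure_mono_null (fun x hx => ?_) (hVnull (Int.fract (c / δ)))
    have hx' : δ * (⌊ψ x / δ⌋ + V x) = c := hx
    have : c / δ = ⌊ψ x / δ⌋ + V x := by rw [← hx']; field_simp
    show V x = Int.fract (c / δ)
    rw [this, Int.fract_intCast_add, Int.fract_eq_self.2 (hV x)]

/-- Right continuity of the distribution function of a finite measure on `ℝ`. -/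
lemma le_measure_Iic_of_forall_gt (ν : Measure ℝ) [IsFiniteMeasure ν] {a : ENNReal} {t : ℝ}
    (h : ∀ r > t, a ≤ ν (Iic r)) : a ≤ ν (Iic t) := by
  have hlim := tendsto_measure_biInter_gt (μ := ν) (s := fun y : ℝ => Iic y) (a := t)
    (fun _ _ => nullMeasurableSet_Iic) (fun _ _ _ h => Iic_subset_Iic.2 h)
    ⟨t + 1, by simp, measure_ne_top _ _⟩
  have hInter : ⋂ r > t, Iic r = Iic t := by
    ext x
    simp only [mem_iInter, mem_Iic]
    exact ⟨fun h => le_of_forall_gt_imp_ge_of_dense h, fun h r hr => h.trans hr.le⟩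
  rw [hInter] at hlim
  refine ge_of_tendsto hlim ?_
  filter_upwards [self_mem_nhdsWithin] with r hr using h r hr

/-- For a finite measure on `ℝ` without point masses, the distribution function evaluated at a
random point is uniformly distributed. -/
lemma measure_setOf_measure_Iic_le (ν : Measure ℝ) [IsFiniteMeasure ν] [NullSingletonClass ν]
    {a : ENNReal} (ha : a ≤ ν univ) : ν {y | ν (Iic y) ≤ a} = a := by
  set E : Set ℝ := {y | ν (Iic y) ≤ a}
  have hlow : ∀ {x y : ℝ}, x ≤ y → y ∈ E → x ∈ E := fun hxy hy =>
    (measure_mono (Iic_subset_Iic.2 hxy)).trans hy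
  rcases E.eq_empty_or_nonempty with hemp | hne
  · have hlt : ∀ y, a ≤ ν (Iic y) := fun y =>
      (not_le.1 fun h => (hemp ▸ (h : y ∈ E) : y ∈ (∅ : Set ℝ))).le
    have hlim := tendsto_measure_iInter_atBot (μ := ν) (s := fun y : ℝ => Iic y)
      (fun _ => nullMeasurableSet_Iic) monotone_Iic ⟨0, measure_ne_top _ _⟩
    have hInter : ⋂ y : ℝ, Iic y = ∅ := by
      refine eq_empty_of_forall_notMem fun x hx => ?_
      have : x ≤ x - 1 := mem_iInter.1 hx (x - 1)
      linarith
    rw [hInter, measure_empty] at hlim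
    have ha0 : a ≤ 0 := ge_of_tendsto hlim (Eventually.of_forall hlt)
    rw [hemp, measure_empty]
    exact (le_antisymm ha0 bot_le).symm
  by_cases hbdd : BddAbove E
  · have hIio : ν (Iio (sSup E)) ≤ a := by
      obtain ⟨u, hu, hul, hut⟩ := exists_seq_strictMono_tendsto (sSup E)
      have hU : Iio (sSup E) ⊆ ⋃ n, Iic (u n) := fun x hx => by
        obtain ⟨n, hn⟩ := (hut.eventually (lt_mem_nhds hx)).exists
        exact mem_iUnion.2 ⟨n, hn.le⟩
      refine (measure_mono hU).trans ?_
      rw [Monotone.measure_iUnion fun _ _ h => Iic_subset_Iic.2 (hu.monotone h)]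
      refine iSup_le fun n => ?_
      obtain ⟨y, hy, hlt⟩ := exists_lt_of_lt_csSup hne (hul n)
      exact hlow hlt.le hy
    have hIic : a ≤ ν (Iic (sSup E)) := le_measure_Iic_of_forall_gt ν fun y hy =>
      (not_le.1 fun h => (notMem_of_csSup_lt hy hbdd) h).le
    have hEq : ν (Iio (sSup E)) = ν (Iic (sSup E)) := measure_congr Iio_ae_eq_Iic
    refine le_antisymm ?_ ?_
    · exact (measure_mono fun y hy => le_csSup hbdd hy).trans (hEq ▸ hIio)
    · refine (hIic.trans hEq.ge).trans (measure_mono fun x hx => ?_)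
      obtain ⟨y, hy, hlt⟩ := exists_lt_of_lt_csSup hne hx
      exact hlow hlt.le hy
  · have huniv : E = univ := by
      refine eq_univ_of_forall fun x => ?_
      obtain ⟨y, hy, hlt⟩ := not_bddAbove_iff.1 hbdd x
      exact hlow hlt.le hy
    rw [huniv]
    refine le_antisymm (le_of_tendsto (tendsto_measure_Iic_atTop ν) ?_) ha
    exact Eventually.of_forall fun y => (huniv ▸ mem_univ y : y ∈ E)

/-- Monotone transport on the line: a finite measure without point masses can be pushed forward by
a bounded monotone map to any measure of the same mass supported in `[-K, K]`. -/
lemma exists_monotone_map_eq (ν ρ : Measure ℝ) [IsFiniteMeasure ν] [NullSingletonClass ν]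
    (hmass : ν univ = ρ univ) {K : ℝ} (hK : 0 ≤ K) (hρ : ρ (Icc (-K) K)ᶜ = 0) :
    ∃ T : ℝ → ℝ, Monotone T ∧ (∀ y, |T y| ≤ K) ∧ Measure.map T ν = ρ := by
  have : IsFiniteMeasure ρ := ⟨hmass ▸ measure_lt_top ν univ⟩
  let S : ℝ → Set ℝ := fun y => {t | t ∈ Icc (-K) K ∧ ν (Iic y) ≤ ρ (Iic t)}
  have hρK : ∀ t, K ≤ t → ρ (Iic t) = ρ univ := fun t ht => by
    refine measure_congr (ae_eq_univ.2 (measure_mono_null (fun x hx => ?_) hρ))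
    exact fun h => hx (h.2.trans ht)
  have hKS : ∀ y, K ∈ S y := fun y =>
    ⟨⟨by linarith, le_rfl⟩, by rw [hρK K le_rfl, ← hmass]; exact measure_mono (subset_univ _)⟩
  have hbdd : ∀ y, BddBelow (S y) := fun y => ⟨-K, fun t ht => ht.1.1⟩
  let T : ℝ → ℝ := fun y => sInf (S y)
  have hTK : ∀ y, T y ≤ K := fun y => csInf_le (hbdd y) (hKS y)
  have hKT : ∀ y, -K ≤ T y := fun y => le_csInf ⟨K, hKS y⟩ fun t ht => ht.1.1
  have hTmono : Monotone T := fun x y hxy =>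
    csInf_le_csInf (hbdd x) ⟨K, hKS y⟩ fun t ht =>
      ⟨ht.1, (measure_mono (Iic_subset_Iic.2 hxy)).trans ht.2⟩
  have hgalois : ∀ t, -K ≤ t → ∀ y, T y ≤ t ↔ ν (Iic y) ≤ ρ (Iic t) := by
    intro t ht y
    constructor
    · intro h
      refine le_measure_Iic_of_forall_gt ρ fun r hr => ?_
      obtain ⟨s, hs, hsr⟩ := exists_lt_of_csInf_lt ⟨K, hKS y⟩ (h.trans_lt hr)
      exact hs.2.trans (measure_mono (Iic_subset_Iic.2 hsr.le))
    · intro h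
      rcases le_total t K with htK | htK
      · exact csInf_le (hbdd y) ⟨⟨ht, htK⟩, h⟩
      · exact (hTK y).trans htK
  refine ⟨T, hTmono, fun y => abs_le.2 ⟨hKT y, hTK y⟩, ?_⟩
  refine Measure.ext_of_Iic _ _ fun t => ?_
  rw [Measure.map_apply hTmono.measurable measurableSet_Iic]
  rcases le_or_gt (-K) t with ht | ht
  · have : T ⁻¹' Iic t = {y | ν (Iic y) ≤ ρ (Iic t)} := ext fun y => hgalois t ht y
    rw [this]
    exact measure_setOf_measure_Iic_le ν (hmass ▸ measure_mono (subset_univ _))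
  · have h1 : T ⁻¹' Iic t = ∅ :=
      eq_empty_of_forall_notMem fun y hy => absurd (ht.trans_le (hKT y)) (not_lt.2 hy)
    rw [h1, measure_empty]
    exact (measure_mono_null (fun x hx h => absurd (ht.trans_le h.1) (not_lt.2 hx)) hρ).symm

/-- Layer-cake formula for weighted integrals of a nonnegative bounded function. -/
lemma integral_mul_eq_integral_superlevel {X : Type*} [MeasurableSpace X] {μ : Measure X}
    [IsFiniteMeasure μ] {f ψ : X → ℝ} (hf : Measurable f) {K : ℝ}
    (hfK : ∀ᵐ x ∂μ, 0 ≤ f x ∧ f x ≤ K) (hψ : Integrable ψ μ) :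
    Integrable (fun t => ∫ x in {x | t < f x}, ψ x ∂μ) (volume.restrict (Ioc 0 K)) ∧
      ∫ x, f x * ψ x ∂μ = ∫ t in Ioc 0 K, ∫ x in {x | t < f x}, ψ x ∂μ := by
  have hmeas : ∀ t, MeasurableSet {x | t < f x} := fun t => measurableSet_lt measurable_const hf
  let F : ℝ × X → ℝ := {p : ℝ × X | p.1 < f p.2}.indicator fun p => ψ p.2
  have hset : MeasurableSet {p : ℝ × X | p.1 < f p.2} :=
    measurableSet_lt measurable_fst (hf.comp measurable_snd)
  have hint : Integrable F ((volume.restrict (Ioc 0 K)).prod μ) :=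
    (hψ.comp_snd _).indicator hset
  have hinner : ∀ t, ∫ x, F (t, x) ∂μ = ∫ x in {x | t < f x}, ψ x ∂μ := fun t => by
    rw [← integral_indicator (hmeas t)]
    rfl
  refine ⟨by simpa only [hinner] using hint.integral_prod_left, ?_⟩
  simp_rw [← hinner]
  rw [integral_integral_swap (f := fun t x => F (t, x)) hint]
  refine integral_congr_ae ?_
  filter_upwards [hfK] with x hx
  have h1 : (fun t => F (t, x)) = (Iio (f x)).indicator fun _ => ψ x := by
    ext t
    rfl
  have h2 : Iio (f x) ∩ Ioc 0 K = Ioo 0 (f x) := by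
    ext t
    simp only [mem_inter_iff, mem_Iio, mem_Ioc, mem_Ioo]
    constructor
    · rintro ⟨a, b, c⟩; exact ⟨b, a⟩
    · rintro ⟨a, b⟩; exact ⟨b, a, b.le.trans hx.2⟩
  simp only [h1]
  rw [integral_indicator measurableSet_Iio, Measure.restrict_restrict measurableSet_Iio, h2,
    setIntegral_const, Real.volume_real_Ioo_of_le hx.1, sub_zero, smul_eq_mul]

/-- Superlevel sets of a monotone function of a bounded `g` are, up to ties, superlevel sets
of `g`. -/
lemma Monotone.exists_threshold {X : Type*} {T : ℝ → ℝ} (hT : Monotone T) {g : X → ℝ} {C : ℝ}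
    (hg : ∀ x, |g x| ≤ C) (t : ℝ) :
    ∃ c, ∀ x, (t < T (g x) → c ≤ g x) ∧ (T (g x) ≤ t → g x ≤ c) := by
  rcases eq_empty_or_nonempty (g '' {x | T (g x) ≤ t}) with h | h
  · refine ⟨-C, fun x => ⟨fun _ => (abs_le.1 (hg x)).1, fun hx => ?_⟩⟩
    exact absurd (mem_image_of_mem g (show x ∈ {x | T (g x) ≤ t} from hx)) (h ▸ notMem_empty _)
  · refine ⟨sSup (g '' {x | T (g x) ≤ t}), fun x => ⟨fun hx => csSup_le h ?_, fun hx => ?_⟩⟩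
    · rintro _ ⟨y, hy, rfl⟩
      by_contra! hlt
      exact absurd (hx.trans_le (hT hlt.le)) (not_lt.2 hy)
    · refine le_csSup ⟨C, ?_⟩ ⟨x, hx, rfl⟩
      rintro _ ⟨y, -, rfl⟩
      exact (abs_le.1 (hg y)).2

/-- A Hardy–Littlewood inequality: among sets of given measure, the integral of `g` is largest
over a superlevel set. -/
lemma setIntegral_le_of_threshold {X : Type*} [MeasurableSpace X] {μ : Measure X}
    [IsFiniteMeasure μ] {g : X → ℝ} (hg : Integrable g μ) {A B : Set X} (hA : MeasurableSet A)
    (hB : MeasurableSet B) (hAB : μ A = μ B) {c : ℝ} (hc : ∀ x ∈ B, c ≤ g x)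
    (hc' : ∀ x ∉ B, g x ≤ c) : ∫ x in A, g x ∂μ ≤ ∫ x in B, g x ∂μ := by
  have hi : Integrable (fun x => g x - c) μ := hg.sub (integrable_const c)
  have hle : ∫ x in A, (g x - c) ∂μ ≤ ∫ x in B, (g x - c) ∂μ := by
    rw [← integral_indicator hA, ← integral_indicator hB]
    refine integral_mono (hi.indicator hA) (hi.indicator hB) fun x => ?_
    by_cases hxA : x ∈ A <;> by_cases hxB : x ∈ B <;> simp [hxA, hxB]
    · exact hc' x hxB
    · exact hc x hxB
  rw [integral_sub hg.integrableOn (integrable_const c), integral_sub hg.integrableOn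
    (integrable_const c), setIntegral_const, setIntegral_const, measureReal_def, measureReal_def,
    hAB] at hle
  linarith

/-- Chebyshev's integral inequality for a bounded function and a monotone function of it. -/
lemma average_mul_integral_le_of_monotone {X : Type*} [MeasurableSpace X] {μ : Measure X}
    [IsFiniteMeasure μ] {T : ℝ → ℝ} (hT : Monotone T) {g : X → ℝ} {C : ℝ}
    (hgC : ∀ x, |g x| ≤ C) (hg : Integrable g μ) (hTg : Integrable (fun x => T (g x)) μ)
    (hmul : Integrable (fun x => T (g x) * g x) μ) :
    (⨍ x, T (g x) ∂μ) * ∫ x, g x ∂μ ≤ ∫ x, T (g x) * g x ∂μ := by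
  set m := ⨍ x, T (g x) ∂μ
  obtain ⟨c, hc⟩ := hT.exists_threshold hgC m
  have h0 : 0 ≤ ∫ x, (T (g x) - m) * (g x - c) ∂μ := integral_nonneg fun x => by
    rcases lt_or_ge m (T (g x)) with h | h
    · exact mul_nonneg (sub_nonneg.2 h.le) (sub_nonneg.2 ((hc x).1 h))
    · exact mul_nonneg_of_nonpos_of_nonpos (sub_nonpos.2 h) (sub_nonpos.2 ((hc x).2 h))
  have h1 : ∫ x, (T (g x) - m) ∂μ = 0 := integral_sub_average μ _
  have h2 : ∀ x, (T (g x) - m) * (g x - c) = (T (g x) * g x - m * g x) - c * (T (g x) - m) :=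
    fun x => by ring
  simp_rw [h2] at h0
  have hi1 : Integrable (fun x => T (g x) * g x - m * g x) μ := hmul.sub (hg.const_mul m)
  have hi2 : Integrable (fun x => c * (T (g x) - m)) μ :=
    (hTg.sub (integrable_const m)).const_mul c
  rw [integral_sub hi1 hi2, integral_sub hmul (hg.const_mul m), integral_const_mul,
    integral_const_mul, h1] at h0
  linarith

/-- The product of an a.e. bounded function with a bounded function is integrable. -/
lemma integrable_mul_of_bounded {X : Type*} [MeasurableSpace X] {μ : Measure X}
    [IsFiniteMeasure μ] {f g : X → ℝ} (hf : Measurable f) {K : ℝ} (hfK : ∀ᵐ x ∂μ, |f x| ≤ K)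
    (hg : Measurable g) {C : ℝ} (hgC : ∀ x, |g x| ≤ C) : Integrable (fun x => f x * g x) μ := by
  refine (Integrable.of_bound hg.aestronglyMeasurable C
    (Eventually.of_forall hgC)).bdd_mul (c := K) hf.aestronglyMeasurable hfK

/-- Functions with the same distribution share almost everywhere bounds. -/
lemma ae_abs_le_of_map_eq {X : Type*} [MeasurableSpace X] {μ : Measure X} {f g : X → ℝ}
    (hf : Measurable f) (hg : Measurable g) (h : Measure.map f μ = Measure.map g μ) {K : ℝ}
    (hgK : ∀ᵐ x ∂μ, |g x| ≤ K) : ∀ᵐ x ∂μ, |f x| ≤ K :=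
  (ProbabilityTheory.IdentDistrib.mk hg.aemeasurable hf.aemeasurable h.symm).ae_snd
    (p := fun y => |y| ≤ K) (measurableSet_le measurable_id.abs measurable_const) hgK

/-- Up to `ε`, some rearrangement `φ₁` of `φ` satisfies
`∫ φ⁺ ψ ≤ ∫ φ₁ ψ + (⨍ φ⁻) ∫ ψ`. -/
lemma Nonatomic.exists_rearrangement_integral_posPart_le {X : Type*} [MeasurableSpace X]
    {μ : Measure X} [IsFiniteMeasure μ] (hμ : Nonatomic μ) {φ : X → ℝ} (hφ : Measurable φ)
    {K : ℝ} (hK : 0 ≤ K) (hφK : ∀ᵐ x ∂μ, |φ x| ≤ K) {ψ : X → ℝ} (hψ : Measurable ψ) {C : ℝ}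
    (hψC : ∀ x, |ψ x| ≤ C) {ε : ℝ} (hε : 0 < ε) :
    ∃ φ₁ : X → ℝ, Measurable φ₁ ∧ Measure.map φ₁ μ = Measure.map φ μ ∧
      ∫ x, max (φ x) 0 * ψ x ∂μ
        ≤ ∫ x, φ₁ x * ψ x ∂μ + (⨍ x, max (-φ x) 0 ∂μ) * ∫ x, ψ x ∂μ + ε := by
  set M := μ.real univ
  have hM0 : 0 ≤ M := measureReal_nonneg
  set δ := ε / (3 * (K * M) + 1)
  have hden : 0 < 3 * (K * M) + 1 := by positivity
  have hδ0 : 0 < δ := by positivity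
  obtain ⟨g, hg, hψg, hgnull⟩ := hμ.exists_close_level_null hψ hδ0
  have hgC : ∀ x, |g x| ≤ C + δ := fun x => by
    have h1 := abs_le.1 (hψg x)
    have h2 := abs_le.1 (hψC x)
    exact abs_le.2 ⟨by linarith, by linarith⟩
  have : NullSingletonClass (Measure.map g μ) := ⟨fun c => by
    rw [Measure.map_apply hg (measurableSet_singleton c)]
    exact hgnull c⟩
  have hsupp : Measure.map φ μ (Icc (-K) K)ᶜ = 0 := by
    rw [Measure.map_apply hφ measurableSet_Icc.compl]
    refine measure_mono_null (fun x hx h => hx (abs_le.1 h)) hφK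
  obtain ⟨T, hT, hTK, hTmap⟩ := exists_monotone_map_eq (Measure.map g μ) (Measure.map φ μ)
    (by rw [Measure.map_apply hg .univ, Measure.map_apply hφ .univ]; rfl) hK hsupp
  have hφ₁ : Measurable fun x => T (g x) := hT.measurable.comp hg
  have hmap : Measure.map (fun x => T (g x)) μ = Measure.map φ μ := by
    rw [← hTmap, Measure.map_map hT.measurable hg]; rfl
  have hgi : Integrable g μ :=
    Integrable.of_bound hg.aestronglyMeasurable _ (Eventually.of_forall hgC)
  have hψi : Integrable ψ μ :=
    Integrable.of_bound hψ.aestronglyMeasurable _ (Eventually.of_forall hψC)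
  have hclose : ∀ u : X → ℝ, Measurable u → (∀ᵐ x ∂μ, |u x| ≤ K) →
      |∫ x, u x * ψ x ∂μ - ∫ x, u x * g x ∂μ| ≤ K * δ * M := by
    intro u hu huK
    rw [← integral_sub (integrable_mul_of_bounded hu huK hψ hψC)
      (integrable_mul_of_bounded hu huK hg hgC), ← Real.norm_eq_abs]
    refine norm_integral_le_of_norm_le_const (huK.mono fun x hx => ?_)
    rw [Real.norm_eq_abs, ← mul_sub, abs_mul]
    exact mul_le_mul hx (hψg x) (abs_nonneg _) hK
  have hposK : ∀ {a : ℝ}, |a| ≤ K → 0 ≤ max a 0 ∧ max a 0 ≤ K := fun h =>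
    ⟨le_max_right _ _, max_le (abs_le.1 h).2 hK⟩
  have habsK : ∀ {a : ℝ}, |a| ≤ K → |max a 0| ≤ K := fun h => by
    rw [abs_of_nonneg (hposK h).1]; exact (hposK h).2
  have hHL : ∫ x, max (φ x) 0 * g x ∂μ ≤ ∫ x, max (T (g x)) 0 * g x ∂μ := by
    obtain ⟨hi1, he1⟩ := integral_mul_eq_integral_superlevel (μ := μ) (hφ.max measurable_const)
      (hφK.mono fun x hx => hposK hx) hgi
    obtain ⟨hi2, he2⟩ := integral_mul_eq_integral_superlevel (μ := μ) (hφ₁.max measurable_const)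
      (Eventually.of_forall fun x => hposK (hTK (g x))) hgi
    rw [he1, he2]
    refine setIntegral_mono_on hi1 hi2 measurableSet_Ioc fun t ht => ?_
    have hmax : ∀ a : ℝ, t < max a 0 ↔ t < a := fun a => by simp [ht.1.not_gt]
    simp only [hmax]
    obtain ⟨c, hc⟩ := hT.exists_threshold hgC t
    refine setIntegral_le_of_threshold (c := c) hgi (measurableSet_lt measurable_const hφ)
      (measurableSet_lt measurable_const hφ₁) ?_ (fun x hx => (hc x).1 hx)
      (fun x hx => (hc x).2 (not_lt.1 hx))
    have := congrArg (fun m : Measure ℝ => m (Ioi t)) hmap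
    simp only [Measure.map_apply hφ measurableSet_Ioi,
      Measure.map_apply hφ₁ measurableSet_Ioi] at this
    exact this.symm
  set p := ⨍ x, max (-φ x) 0 ∂μ with hp
  have hTneg : Monotone fun y => -max (-T y) 0 := fun x y hxy =>
    neg_le_neg (max_le_max (neg_le_neg (hT hxy)) le_rfl)
  have hnegm : Measurable fun x => -max (-T (g x)) 0 := (hφ₁.neg.max measurable_const).neg
  have hnegK : ∀ x, |-max (-T (g x)) 0| ≤ K := fun x => by
    rw [abs_neg]; exact habsK (by rw [abs_neg]; exact hTK _)
  have hnegi : Integrable (fun x => -max (-T (g x)) 0 * g x) μ :=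
    integrable_mul_of_bounded hnegm (Eventually.of_forall hnegK) hg hgC
  have hCheb := average_mul_integral_le_of_monotone hTneg hgC hgi
    (Integrable.of_bound hnegm.aestronglyMeasurable K (Eventually.of_forall hnegK)) hnegi
  have hident := (ProbabilityTheory.IdentDistrib.mk hφ₁.aemeasurable hφ.aemeasurable hmap).comp
    (u := fun y => max (-y) 0) (by fun_prop)
  have hav : ⨍ x, -max (-T (g x)) 0 ∂μ = -p := by
    have : ∫ x, max (-T (g x)) 0 ∂μ = ∫ x, max (-φ x) 0 ∂μ := hident.integral_eq
    rw [hp, average_eq, average_eq, integral_neg, this, smul_neg]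
  rw [hav] at hCheb
  have hpK : |p| ≤ K := by
    rw [hp, average_eq, smul_eq_mul, abs_mul, abs_of_nonneg (inv_nonneg.2 measureReal_nonneg)]
    have h1 : |∫ x, max (-φ x) 0 ∂μ| ≤ K * M := by
      rw [← Real.norm_eq_abs]
      exact norm_integral_le_of_norm_le_const (hφK.mono fun x hx => habsK (by rwa [abs_neg]))
    calc M⁻¹ * |∫ x, max (-φ x) 0 ∂μ| ≤ M⁻¹ * (K * M) := by gcongr
      _ = K * (M⁻¹ * M) := by ring
      _ ≤ K * 1 := by gcongr; exact inv_mul_le_one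
      _ = K := mul_one K
  have hsplit : ∫ x, T (g x) * g x ∂μ
      = ∫ x, max (T (g x)) 0 * g x ∂μ + ∫ x, -max (-T (g x)) 0 * g x ∂μ := by
    rw [← integral_add (integrable_mul_of_bounded (hφ₁.max measurable_const)
      (Eventually.of_forall fun x => habsK (hTK _)) hg hgC) hnegi]
    refine integral_congr_ae (Eventually.of_forall fun x => ?_)
    rcases le_total (T (g x)) 0 with h | h <;> simp [h]
  have e1 := abs_le.1 (hclose _ (hφ.max measurable_const) (hφK.mono fun x hx => habsK hx))
  have e2 := abs_le.1 (hclose _ hφ₁ (Eventually.of_forall fun x => hTK _))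
  have e3 := abs_le.1 (hclose (fun _ => p) measurable_const (Eventually.of_forall fun _ => hpK))
  simp only [integral_const_mul] at e3
  have hδε : 3 * (K * δ * M) ≤ ε := by
    have : δ * (3 * (K * M) + 1) = ε := div_mul_cancel₀ _ hden.ne'
    nlinarith
  refine ⟨fun x => T (g x), hφ₁, hmap, ?_⟩
  linarith [e1.2, e2.1, e3.1]

/-- The weighted integrals of the rearrangements of a bounded function are bounded above. -/
lemma bddAbove_integral_rearrangement {X : Type*} [MeasurableSpace X] {μ : Measure X}
    [IsFiniteMeasure μ] {φ₀ : X → ℝ} (hφ₀ : Measurable φ₀) {K : ℝ} (hφ₀K : ∀ x, |φ₀ x| ≤ K)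
    {ψ : X → ℝ} {C : ℝ} (hψC : ∀ x, |ψ x| ≤ C) {u : ℝ → ℝ} (hu : ∀ y, |u y| ≤ |y|) :
    BddAbove {r : ℝ | ∃ φ : X → ℝ, Measurable φ ∧ Measure.map φ μ = Measure.map φ₀ μ ∧
      r = ∫ x, u (φ x) * ψ x ∂μ} := by
  refine ⟨K * C * μ.real univ, ?_⟩
  rintro _ ⟨φ, hφ, hmap, rfl⟩
  have hae := ae_abs_le_of_map_eq hφ hφ₀ hmap (Eventually.of_forall hφ₀K)
  refine (Real.le_norm_self _).trans
    (norm_integral_le_of_norm_le_const (hae.mono fun x hx => ?_))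
  rw [Real.norm_eq_abs, abs_mul]
  exact mul_le_mul ((hu _).trans hx) (hψC x) (abs_nonneg _) ((abs_nonneg _).trans hx)

end

/-- Lemma 7.4: for `φ₀, ψ ∈ L^∞`,
`sup_{φ ∼ φ₀} ∫ |φ| ψ ≤ sup_{φ ∼ φ₀} ∫ φ ψ + sup_{φ ∼ φ₀} ∫ (−φ) ψ + (⨍|φ₀|) ∫ ψ`. -/
theorem stmt13 {X : Type*} [MeasurableSpace X] (μ : Measure X) [IsFiniteMeasure μ]
    (hμ : Nonatomic μ)
    (φ₀ : X → ℝ) (hφm : Measurable φ₀) (C₀ : ℝ) (hφb : ∀ x, |φ₀ x| ≤ C₀)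
    (ψ : X → ℝ) (hψm : Measurable ψ) (C : ℝ) (hψb : ∀ x, |ψ x| ≤ C) :
    sSup {r : ℝ | ∃ φ : X → ℝ, Measurable φ ∧ Measure.map φ μ = Measure.map φ₀ μ ∧
        r = ∫ x, |φ x| * ψ x ∂μ}
      ≤ sSup {r : ℝ | ∃ φ : X → ℝ, Measurable φ ∧ Measure.map φ μ = Measure.map φ₀ μ ∧
          r = ∫ x, φ x * ψ x ∂μ}
        + sSup {r : ℝ | ∃ φ : X → ℝ, Measurable φ ∧ Measure.map φ μ = Measure.map φ₀ μ ∧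
            r = ∫ x, (-φ x) * ψ x ∂μ}
        + (⨍ x, |φ₀ x| ∂μ) * ∫ x, ψ x ∂μ := by
  refine csSup_le ⟨_, φ₀, hφm, rfl, rfl⟩ ?_
  rintro _ ⟨φ, hφ, hmap, rfl⟩
  refine le_of_forall_pos_le_add fun ε hε => ?_
  have hK : 0 ≤ |C₀| := abs_nonneg _
  have hφK : ∀ᵐ x ∂μ, |φ x| ≤ |C₀| := ae_abs_le_of_map_eq hφ hφm hmap
    (Filter.Eventually.of_forall fun x => (hφb x).trans (le_abs_self _))
  have hnegK : ∀ᵐ x ∂μ, |-φ x| ≤ |C₀| := by simpa only [abs_neg] using hφK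
  have hmaxK : ∀ {a : ℝ}, |a| ≤ |C₀| → |max a 0| ≤ |C₀| := fun h => by
    rw [abs_of_nonneg (le_max_right _ _)]
    exact max_le ((le_abs_self _).trans h) hK
  obtain ⟨φ₁, hφ₁, hmap₁, h₁⟩ :=
    hμ.exists_rearrangement_integral_posPart_le hφ hK hφK hψm hψb (half_pos hε)
  obtain ⟨φ₂, hφ₂, hmap₂, h₂⟩ :=
    hμ.exists_rearrangement_integral_posPart_le hφ.neg hK hnegK hψm hψb (half_pos hε)
  have hmap₂' : Measure.map (fun x => -φ₂ x) μ = Measure.map φ₀ μ := by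
    have h := ((ProbabilityTheory.IdentDistrib.mk hφ₂.aemeasurable hφ.neg.aemeasurable
      hmap₂).comp measurable_neg).map_eq
    have hneg : Neg.neg ∘ (-φ) = φ := funext fun x => neg_neg (φ x)
    rw [← hmap]
    rwa [hneg] at h
  have s₁ := le_csSup (bddAbove_integral_rearrangement (μ := μ) hφm hφb hψb (u := fun y => y)
    fun _ => le_rfl) ⟨φ₁, hφ₁, hmap₁.trans hmap, rfl⟩
  have s₂ := le_csSup (bddAbove_integral_rearrangement (μ := μ) hφm hφb hψb (u := fun y => -y)
    fun y => (abs_neg y).le) ⟨fun x => -φ₂ x, hφ₂.neg, hmap₂', rfl⟩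
  simp only [neg_neg, Pi.neg_apply] at s₂ h₂
  have hpi : Integrable (fun x => max (φ x) 0) μ :=
    .of_bound (hφ.max measurable_const).aestronglyMeasurable |C₀| (hφK.mono fun _ hx => hmaxK hx)
  have hni : Integrable (fun x => max (-φ x) 0) μ :=
    .of_bound (hφ.neg.max measurable_const).aestronglyMeasurable |C₀|
      (hnegK.mono fun _ hx => hmaxK hx)
  have habs : ∀ a : ℝ, |a| = max a 0 + max (-a) 0 := fun a => by
    rcases le_total a 0 with h | h <;> simp [h, abs_of_nonneg, abs_of_nonpos]
  have hLHS : ∫ x, |φ x| * ψ x ∂μ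
      = ∫ x, max (φ x) 0 * ψ x ∂μ + ∫ x, max (-φ x) 0 * ψ x ∂μ := by
    rw [← integral_add]
    · simp only [habs, add_mul]
    · exact integrable_mul_of_bounded (hφ.max measurable_const)
        (hφK.mono fun _ hx => hmaxK hx) hψm hψb
    · exact integrable_mul_of_bounded (hφ.neg.max measurable_const)
        (hnegK.mono fun _ hx => hmaxK hx) hψm hψb
  have hav : ⨍ x, |φ₀ x| ∂μ = ⨍ x, max (φ x) 0 ∂μ + ⨍ x, max (-φ x) 0 ∂μ := by
    have : ∫ x, |φ₀ x| ∂μ = ∫ x, |φ x| ∂μ :=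
      ((ProbabilityTheory.IdentDistrib.mk hφm.aemeasurable hφ.aemeasurable
        hmap.symm).comp measurable_id.abs).integral_eq
    simp only [average_eq]
    rw [this, ← smul_add, ← integral_add hpi hni]
    simp only [habs]
  rw [hLHS, hav, add_mul]
  linarith
end

section
/- Let (X, μ) be a finite nonatomic measure space and let f₀, ξ ∈ L^∞(X, μ). Then sup{ ∫_X |f ξ| dμ : f equidistributed with f₀ } ≤ 4 · sup{ |∫_X f ξ dμ| : f equidistributed with f₀ } + 3 (⨍_X |f₀| dμ) ∫_X |ξ| dμ. -/
open MeasureTheory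

/-- On a finite nonatomic measure space there is a real random variable whose law has no atoms. -/
theorem Nonatomic.exists_measurable_measure_fiber_eq_zero {X : Type*} [MeasurableSpace X]
    {μ : Measure X} [IsFiniteMeasure μ] (hμ : Nonatomic μ) :
    ∃ V : X → ℝ, Measurable V ∧ ∀ c, μ {x | V x = c} = 0 := by
  let D : (X → ℝ) → Set (X × X) := fun V => {p | V p.1 = V p.2}
  let S : Set ENNReal := {r | ∃ V : X → ℝ, Measurable V ∧ r = (μ.prod μ) (D V)}
  obtain ⟨u, -, hu, huS⟩ := exists_seq_tendsto_sInf (S := S)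
    ⟨_, fun _ => 0, measurable_const, rfl⟩ (OrderBot.bddBelow S)
  choose V hVm hV using huS
  let e := embeddingReal (ℕ → ℝ)
  have he : MeasurableEmbedding e := measurableEmbedding_embeddingReal _
  let W : X → ℝ := fun x => e (fun n => V n x)
  have hWm : Measurable W := he.measurable.comp (measurable_pi_lambda _ hVm)
  have hW : (μ.prod μ) (D W) ≤ sInf S := by
    refine ge_of_tendsto' hu fun n => ?_
    rw [hV n]
    refine measure_mono fun p hp => ?_
    exact congrFun (he.injective hp) n
  refine ⟨W, hWm, fun c => ?_⟩
  by_contra hc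
  have hs : MeasurableSet {x | W x = c} := hWm (measurableSet_singleton c)
  obtain ⟨t, hts, ht, ht0, htlt⟩ := hμ _ hs (pos_iff_ne_zero.2 hc)
  let e₂ := embeddingReal (ℝ × ℝ)
  have he₂ : MeasurableEmbedding e₂ := measurableEmbedding_embeddingReal _
  let W₂ : X → ℝ := fun x => e₂ (W x, t.indicator 1 x)
  have hW₂m : Measurable W₂ :=
    he₂.measurable.comp (hWm.prodMk (measurable_one.indicator ht))
  have hD₂ : MeasurableSet (D W₂) :=
    measurableSet_eq_fun (hW₂m.comp measurable_fst) (hW₂m.comp measurable_snd)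
  have hpos : 0 < (μ.prod μ) (t ×ˢ ({x | W x = c} \ t)) := by
    rw [Measure.prod_prod]
    refine ENNReal.mul_pos ht0.ne' ?_
    rw [measure_sdiff hts ht.nullMeasurableSet (measure_ne_top _ _)]
    exact (tsub_pos_of_lt htlt).ne'
  have hdisj : Disjoint (D W₂) (t ×ˢ ({x | W x = c} \ t)) := by
    rw [Set.disjoint_left]
    rintro ⟨x, y⟩ hxy ⟨hx, -, hy⟩
    have := congrArg Prod.snd (he₂.injective hxy)
    simp [hx, show y ∉ t from hy] at this
  have hsub : D W₂ ∪ t ×ˢ ({x | W x = c} \ t) ⊆ D W := by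
    rintro ⟨x, y⟩ (hxy | ⟨hx, hy, -⟩)
    · exact congrArg Prod.fst (he₂.injective hxy)
    · exact (hts hx : W x = c).trans (Eq.symm hy)
  have h1 := measure_mono (μ := μ.prod μ) hsub
  rw [measure_union hdisj (ht.prod (hs.diff ht))] at h1
  have h2 : sInf S ≤ (μ.prod μ) (D W₂) := sInf_le ⟨W₂, hW₂m, rfl⟩
  have h3 : (μ.prod μ) (D W₂) < (μ.prod μ) (D W₂) + (μ.prod μ) (t ×ˢ ({x | W x = c} \ t)) :=
    ENNReal.lt_add_right (measure_ne_top _ _) hpos.ne'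
  exact absurd (h3.trans_le (h1.trans (hW.trans h2))) (lt_irrefl _)

theorem measureReal_le_of_forall_isCompact {ν : Measure ℝ} [IsFiniteMeasure ν] {A : Set ℝ}
    (hA : MeasurableSet A) {r : ℝ} (h : ∀ K ⊆ A, IsCompact K → K.Nonempty → ν.real K ≤ r)
    (hr : 0 ≤ r) : ν.real A ≤ r := by
  refine ENNReal.toReal_le_of_le_ofReal hr ?_
  rw [hA.measure_eq_iSup_isCompact]
  refine iSup_le fun K => iSup_le fun hKA => iSup_le fun hK => ?_
  rcases K.eq_empty_or_nonempty with rfl | hne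
  · simp
  · rw [ENNReal.le_ofReal_iff_toReal_le (measure_ne_top _ _) hr]
    exact h K hKA hK hne

theorem measureReal_le_of_forall_Iic {ν : Measure ℝ} [IsFiniteMeasure ν] {A : Set ℝ}
    (hA : MeasurableSet A) {r : ℝ} (h : ∀ q ∈ A, ν.real (Set.Iic q) ≤ r) (hr : 0 ≤ r) :
    ν.real A ≤ r := by
  refine measureReal_le_of_forall_isCompact hA (fun K hKA hK hne => ?_) hr
  obtain ⟨q, hq⟩ := hK.exists_isGreatest hne
  exact (measureReal_mono fun x hx => hq.2 hx).trans (h q (hKA hq.1))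

theorem measureReal_le_of_forall_Ici {ν : Measure ℝ} [IsFiniteMeasure ν] {A : Set ℝ}
    (hA : MeasurableSet A) {r : ℝ} (h : ∀ q ∈ A, ν.real (Set.Ici q) ≤ r) (hr : 0 ≤ r) :
    ν.real A ≤ r := by
  refine measureReal_le_of_forall_isCompact hA (fun K hKA hK hne => ?_) hr
  obtain ⟨q, hq⟩ := hK.exists_isLeast hne
  exact (measureReal_mono fun x hx => hq.2 hx).trans (h q (hKA hq.1))

/-- Probability integral transform: the distribution function of an atomless measure is uniformly
distributed. -/
theorem measureReal_setOf_measureReal_Iic_le {ν : Measure ℝ} [IsFiniteMeasure ν] [NullSingletonClass ν]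
    {p : ℝ} (hp : 0 ≤ p) (hp' : p ≤ ν.real Set.univ) :
    ν.real {w | ν.real (Set.Iic w) ≤ p} = p := by
  have hmono : Monotone fun w => ν.real (Set.Iic w) := fun a b hab =>
    measureReal_mono (Set.Iic_subset_Iic.2 hab)
  have hT : MeasurableSet {w | ν.real (Set.Iic w) ≤ p} :=
    measurableSet_le hmono.measurable measurable_const
  refine le_antisymm (measureReal_le_of_forall_Iic hT (fun q hq => hq) hp) ?_
  have h := measureReal_le_of_forall_Ici (ν := ν) (r := ν.real Set.univ - p) hT.compl ?_
    (sub_nonneg.2 hp')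
  · rw [measureReal_compl hT] at h
    linarith
  · intro q hq
    have hq' : p < ν.real (Set.Iic q) := not_le.1 hq
    have h1 : ν.real (Set.Ici q) = ν.real (Set.Ioi q) :=
      measureReal_congr Ioi_ae_eq_Ici.symm
    rw [h1, ← Set.compl_Iic, measureReal_compl measurableSet_Iic]
    linarith

/-- The monotone transport map between an atomless and a boundedly supported measure on the
line. -/
theorem exists_monotone_map_eq_s14 {ν ρ : Measure ℝ} [IsFiniteMeasure ν] [IsFiniteMeasure ρ]
    [NullSingletonClass ν] (hmass : ν.real Set.univ = ρ.real Set.univ) {a b : ℝ}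
    (ha : ρ (Set.Iio a) = 0) (hb : ρ (Set.Ioi b) = 0) :
    ∃ h : ℝ → ℝ, Monotone h ∧ Measure.map h ν = ρ := by
  let A : ℝ → Set ℝ := fun w => {c | a ≤ c ∧ ν.real (Set.Iic w) ≤ ρ.real (Set.Iic c)}
  have hmem : ∀ w c, max a b ≤ c → c ∈ A w := by
    intro w c hc
    refine ⟨(le_max_left _ _).trans hc, ?_⟩
    have h0 : ρ.real (Set.Ioi c) = 0 := by
      rw [measureReal_eq_zero_iff]
      exact measure_mono_null (Set.Ioi_subset_Ioi ((le_max_right _ _).trans hc)) hb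
    have h1 := measureReal_compl (μ := ρ) (s := Set.Iic c) measurableSet_Iic
    rw [Set.compl_Iic, h0, ← hmass] at h1
    have h2 : ν.real (Set.Iic w) ≤ ν.real Set.univ := measureReal_mono (Set.subset_univ _)
    linarith
  have hne : ∀ w, (A w).Nonempty := fun w => ⟨_, hmem w _ le_rfl⟩
  have hbdd : ∀ w, BddBelow (A w) := fun w => ⟨a, fun c hc => hc.1⟩
  let h : ℝ → ℝ := fun w => sInf (A w)
  have hmono : Monotone h := fun w w' hw =>
    csInf_le_csInf (hbdd w) (hne w') fun c hc =>
      ⟨hc.1, (measureReal_mono (Set.Iic_subset_Iic.2 hw)).trans hc.2⟩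
  have hle : ∀ w c, a ≤ c → (h w ≤ c ↔ ν.real (Set.Iic w) ≤ ρ.real (Set.Iic c)) := by
    intro w c hac
    refine ⟨fun hc => ?_, fun hc => csInf_le (hbdd w) ⟨hac, hc⟩⟩
    have hc' : ∀ c', c < c' → ν.real (Set.Iic w) ≤ ρ.real (Set.Iic c') := by
      intro c' hcc'
      obtain ⟨d, hd, hdc⟩ := exists_lt_of_csInf_lt (hne w) (hc.trans_lt hcc')
      exact hd.2.trans (measureReal_mono (Set.Iic_subset_Iic.2 hdc.le))
    have key := measureReal_le_of_forall_Ici (ν := ρ) (A := Set.Ioi c)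
      (r := ρ.real Set.univ - ν.real (Set.Iic w)) measurableSet_Ioi ?_ ?_
    · rw [← Set.compl_Iic, measureReal_compl measurableSet_Iic] at key
      linarith
    · intro q hq
      obtain ⟨c', h1, h2⟩ := exists_between (show c < q from hq)
      have h3 : ρ.real (Set.Ici q) ≤ ρ.real (Set.Iic c')ᶜ :=
        measureReal_mono fun x hx => not_le.2 (h2.trans_le hx)
      rw [measureReal_compl measurableSet_Iic] at h3
      linarith [hc' c' h1]
    · rw [← hmass, sub_nonneg]
      exact measureReal_mono (Set.subset_univ _)
  refine ⟨h, hmono, Measure.ext_of_Iic _ _ fun c => ?_⟩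
  rw [Measure.map_apply hmono.measurable measurableSet_Iic]
  rcases lt_or_ge c a with hca | hac
  · have h1 : h ⁻¹' Set.Iic c = ∅ := by
      refine Set.eq_empty_of_forall_notMem fun w hw => ?_
      exact absurd ((le_csInf (hne w) fun d hd => hd.1).trans hw) (not_le.2 hca)
    rw [h1, measure_empty, measure_mono_null (Set.Iic_subset_Iio.2 hca) ha]
  · have h1 : h ⁻¹' Set.Iic c = {w | ν.real (Set.Iic w) ≤ ρ.real (Set.Iic c)} :=
      Set.ext fun w => hle w c hac
    rw [h1, ← measureReal_eq_measureReal_iff]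
    exact measureReal_setOf_measureReal_Iic_le measureReal_nonneg
      (hmass ▸ measureReal_mono (Set.subset_univ _))

/-- Every bounded function is equidistributed with one that varies monotonically with a prescribed
integer-valued function. -/
theorem Nonatomic.exists_monovary {X : Type*} [MeasurableSpace X]
    {μ : Measure X} [IsFiniteMeasure μ] (hμ : Nonatomic μ) {f : X → ℝ} (hf : Measurable f)
    {C : ℝ} (hC : ∀ x, |f x| ≤ C) {k : X → ℤ} (hk : Measurable k) :
    ∃ f' : X → ℝ, Measurable f' ∧ Measure.map f' μ = Measure.map f μ ∧ Monovary f' k := by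
  obtain ⟨V, hVm, hV⟩ := hμ.exists_measurable_measure_fiber_eq_zero
  let W : X → ℝ := fun x => k x + Real.sigmoid (V x)
  have hWm : Measurable W :=
    ((measurable_from_top (f := fun n : ℤ => (n : ℝ))).comp hk).add
      (Real.sigmoid_monotone.measurable.comp hVm)
  have hfloor : ∀ x, ⌊W x⌋ = k x := fun x => by
    rw [Int.floor_eq_iff]
    have h1 := Real.sigmoid_pos (V x)
    have h2 := Real.sigmoid_lt_one (V x)
    constructor <;> simp only [W] <;> linarith
  have hno : NullSingletonClass (Measure.map W μ) := by
    refine ⟨fun c => ?_⟩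
    rw [Measure.map_apply hWm (measurableSet_singleton c)]
    rcases (W ⁻¹' {c}).eq_empty_or_nonempty with h | ⟨x, hx⟩
    · rw [h, measure_empty]
    · refine measure_mono_null (fun y hy => ?_) (hV (V x))
      have hxy : W y = W x := Eq.trans hy (Eq.symm hx)
      have hkk : k y = k x := by rw [← hfloor, ← hfloor, hxy]
      refine Real.sigmoid_strictMono.injective ?_
      simpa [W, hkk] using hxy
  have hmass : (Measure.map W μ).real Set.univ = (Measure.map f μ).real Set.univ := by
    rw [map_measureReal_apply hWm MeasurableSet.univ,
      map_measureReal_apply hf MeasurableSet.univ, Set.preimage_univ, Set.preimage_univ]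
  have hlow : Measure.map f μ (Set.Iio (-C)) = 0 := by
    rw [Measure.map_apply hf measurableSet_Iio]
    convert measure_empty (μ := μ)
    exact Set.eq_empty_of_forall_notMem fun x hx => absurd (abs_le.1 (hC x)).1 (not_le.2 hx)
  have hhigh : Measure.map f μ (Set.Ioi C) = 0 := by
    rw [Measure.map_apply hf measurableSet_Ioi]
    convert measure_empty (μ := μ)
    exact Set.eq_empty_of_forall_notMem fun x hx => absurd (abs_le.1 (hC x)).2 (not_le.2 hx)
  obtain ⟨h, hmono, hh⟩ := exists_monotone_map_eq_s14 hmass hlow hhigh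
  refine ⟨h ∘ W, hmono.measurable.comp hWm, ?_, fun x y hxy => hmono ?_⟩
  · rw [← hh, Measure.map_map hmono.measurable hWm]
  · by_contra hlt
    have := Int.floor_mono (not_le.1 hlt).le
    rw [hfloor, hfloor] at this
    exact absurd this (not_le.2 hxy)

theorem lintegral_ofReal_mul_ofReal_eq {X : Type*} [MeasurableSpace X] {μ : Measure X}
    [SFinite μ] {a b : X → ℝ} (ha : Measurable a) (hb : Measurable b) :
    ∫⁻ x, ENNReal.ofReal (a x) * ENNReal.ofReal (b x) ∂μ
      = ∫⁻ p : ℝ × ℝ, μ {x | (0 < p.1 ∧ p.1 < a x) ∧ (0 < p.2 ∧ p.2 < b x)} := by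
  let E : Set (X × (ℝ × ℝ)) :=
    {z | (0 < z.2.1 ∧ z.2.1 < a z.1) ∧ (0 < z.2.2 ∧ z.2.2 < b z.1)}
  have hE : MeasurableSet E := by
    refine MeasurableSet.inter (MeasurableSet.inter ?_ ?_) (MeasurableSet.inter ?_ ?_)
    · exact measurableSet_lt (f := fun _ => (0 : ℝ)) (g := fun z : X × ℝ × ℝ => z.2.1) (by fun_prop)
        (by fun_prop)
    · exact measurableSet_lt (f := fun z : X × ℝ × ℝ => z.2.1) (g := fun z => a z.1) (by fun_prop)
        (by fun_prop)
    · exact measurableSet_lt (f := fun _ => (0 : ℝ)) (g := fun z : X × ℝ × ℝ => z.2.2) (by fun_prop)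
        (by fun_prop)
    · exact measurableSet_lt (f := fun z : X × ℝ × ℝ => z.2.2) (g := fun z => b z.1) (by fun_prop)
        (by fun_prop)
  have h1 := Measure.prod_apply (μ := μ) (ν := (volume : Measure (ℝ × ℝ))) hE
  have h2 := Measure.prod_apply_symm (μ := μ) (ν := (volume : Measure (ℝ × ℝ))) hE
  refine Eq.trans ?_ (h1.symm.trans h2)
  refine lintegral_congr fun x => ?_
  have : Prod.mk x ⁻¹' E = Set.Ioo 0 (a x) ×ˢ Set.Ioo 0 (b x) := rfl
  rw [this, Measure.volume_eq_prod, Measure.prod_prod, Real.volume_Ioo, Real.volume_Ioo,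
    sub_zero, sub_zero]

/-- Hardy–Littlewood rearrangement inequality for the positive parts. -/
theorem lintegral_ofReal_mul_le_of_monovary {X : Type*} [MeasurableSpace X] {μ : Measure X}
    [SFinite μ] {a a' b : X → ℝ} (ha : Measurable a) (ha' : Measurable a') (hb : Measurable b)
    (hmap : Measure.map a' μ = Measure.map a μ) (hab : Monovary a' b) :
    ∫⁻ x, ENNReal.ofReal (a x) * ENNReal.ofReal (b x) ∂μ
      ≤ ∫⁻ x, ENNReal.ofReal (a' x) * ENNReal.ofReal (b x) ∂μ := by
  rw [lintegral_ofReal_mul_ofReal_eq ha hb, lintegral_ofReal_mul_ofReal_eq ha' hb]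
  refine lintegral_mono fun ⟨s, t⟩ => ?_
  by_cases hst : 0 < s ∧ 0 < t
  swap
  · have h : {x | (0 < s ∧ s < a x) ∧ (0 < t ∧ t < b x)} = ∅ :=
      Set.eq_empty_of_forall_notMem fun x hx => hst ⟨hx.1.1, hx.2.1⟩
    rw [h, measure_empty]
    exact zero_le
  by_cases hsub : ∀ x, s < a' x → t < b x
  · calc μ {x | (0 < s ∧ s < a x) ∧ (0 < t ∧ t < b x)}
        ≤ μ (a ⁻¹' Set.Ioi s) := measure_mono fun x hx => hx.1.2
      _ = μ (a' ⁻¹' Set.Ioi s) := by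
        rw [← Measure.map_apply ha measurableSet_Ioi, ← hmap,
          Measure.map_apply ha' measurableSet_Ioi]
      _ ≤ μ {x | (0 < s ∧ s < a' x) ∧ (0 < t ∧ t < b x)} :=
        measure_mono fun x hx => ⟨⟨hst.1, hx⟩, hst.2, hsub x hx⟩
  · push Not at hsub
    obtain ⟨y, hy, hyt⟩ := hsub
    exact measure_mono fun x hx =>
      ⟨⟨hst.1, hy.trans_le (hab (hyt.trans_lt hx.2.2))⟩, hx.2⟩

theorem integral_max_mul_max_le_of_monovary {X : Type*} [MeasurableSpace X] {μ : Measure X}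
    [IsFiniteMeasure μ] {a a' b : X → ℝ} (ha : Measurable a) (ha' : Measurable a')
    (hb : Measurable b) (hmap : Measure.map a' μ = Measure.map a μ) (hab : Monovary a' b)
    (hint' : Integrable (fun x => max (a' x) 0 * max (b x) 0) μ) :
    ∫ x, max (a x) 0 * max (b x) 0 ∂μ ≤ ∫ x, max (a' x) 0 * max (b x) 0 ∂μ := by
  have hofReal : ∀ u v : ℝ,
      ENNReal.ofReal (max u 0 * max v 0) = ENNReal.ofReal u * ENNReal.ofReal v := fun u v => by
    rw [ENNReal.ofReal_mul (le_max_right _ _)]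
    simp
  have hnonneg : ∀ c : X → ℝ, 0 ≤ᵐ[μ] fun x => max (c x) 0 * max (b x) 0 := fun c =>
    Filter.Eventually.of_forall fun x => mul_nonneg (le_max_right _ _) (le_max_right _ _)
  have h := lintegral_ofReal_mul_le_of_monovary ha ha' hb hmap hab
  simp only [← hofReal] at h
  rw [integral_eq_lintegral_of_nonneg_ae (hnonneg a) (by fun_prop),
    integral_eq_lintegral_of_nonneg_ae (hnonneg a') (by fun_prop)]
  refine ENNReal.toReal_mono ?_ h
  rw [← ofReal_integral_eq_lintegral_ofReal hint' (hnonneg a')]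
  exact ENNReal.ofReal_ne_top

/-- Chebyshev's integral inequality. -/
theorem integral_mul_le_of_antivary {X : Type*} [MeasurableSpace X] {μ : Measure X}
    [IsFiniteMeasure μ] {a b : X → ℝ} (ha : Integrable a μ) (hb : Integrable b μ)
    (hint : Integrable (fun x => a x * b x) μ) (hab : Antivary a b) :
    ∫ x, a x * b x ∂μ ≤ (μ.real Set.univ)⁻¹ * ((∫ x, a x ∂μ) * ∫ x, b x ∂μ) := by
  rcases eq_or_ne μ 0 with rfl | hμ
  · simp
  have hM : 0 < μ.real Set.univ := by
    have : NeZero μ := ⟨hμ⟩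
    exact measureReal_univ_pos
  have h1 : ∀ y, (∫ x, a x * b x ∂μ) - b y * (∫ x, a x ∂μ) - a y * (∫ x, b x ∂μ)
      + μ.real Set.univ * (a y * b y) ≤ 0 := by
    intro y
    have h2 : ∫ x, (a x - a y) * (b x - b y) ∂μ ≤ 0 := by
      refine integral_nonpos fun x => ?_
      rcases lt_trichotomy (b x) (b y) with h | h | h
      · exact mul_nonpos_of_nonneg_of_nonpos (sub_nonneg.2 (hab h)) (sub_nonpos.2 h.le)
      · simp [h]
      · exact mul_nonpos_of_nonpos_of_nonneg (sub_nonpos.2 (hab h)) (sub_nonneg.2 h.le)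
    have h3 : ∫ x, (a x - a y) * (b x - b y) ∂μ
        = ∫ x, (a x * b x - b y * a x - a y * b x + a y * b y) ∂μ := by
      congr 1; ext x; ring
    rw [h3, integral_add ((hint.sub' (ha.const_mul _)).sub' (hb.const_mul _)) (integrable_const _),
      integral_sub (hint.sub' (ha.const_mul _)) (hb.const_mul _),
      integral_sub hint (ha.const_mul _), integral_const_mul, integral_const_mul,
      integral_const, smul_eq_mul] at h2
    exact h2
  have h4 := integral_nonpos (μ := μ) h1
  rw [integral_add (((integrable_const _).sub' (hb.mul_const _)).sub' (ha.mul_const _))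
      (hint.const_mul _),
    integral_sub ((integrable_const _).sub' (hb.mul_const _)) (ha.mul_const _),
    integral_sub (integrable_const _) (hb.mul_const _), integral_mul_const, integral_mul_const,
    integral_const_mul, integral_const, smul_eq_mul] at h4
  rw [le_inv_mul_iff₀ hM]
  linarith

theorem memLp_top_max_zero {X : Type*} [MeasurableSpace X] {μ : Measure X} {f : X → ℝ}
    (hf : MemLp f ⊤ μ) : MemLp (fun x => max (f x) 0) ⊤ μ :=
  hf.sup MemLp.zero'

theorem integral_max_mul_max_add_le {X : Type*} [MeasurableSpace X] {μ : Measure X}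
    [IsFiniteMeasure μ] {f f' g : X → ℝ} (hf : Measurable f) (hf' : Measurable f')
    (hg : Measurable g) (hmap : Measure.map f' μ = Measure.map f μ) (hfg : Monovary f' g)
    (hfb : MemLp f ⊤ μ) (hf'b : MemLp f' ⊤ μ) (hgb : MemLp g ⊤ μ) :
    ∫ x, (max (f x) 0 * max (g x) 0 + max (-f x) 0 * max (-g x) 0) ∂μ
      ≤ (∫ x, f' x * g x ∂μ)
        + (μ.real Set.univ)⁻¹ * ((∫ x, max (-f x) 0 ∂μ) * (∫ x, max (g x) 0 ∂μ)
          + (∫ x, max (f x) 0 ∂μ) * ∫ x, max (-g x) 0 ∂μ) := by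
  have hint : ∀ {a b : X → ℝ}, MemLp a ⊤ μ → MemLp b ⊤ μ →
      Integrable (fun x => max (a x) 0 * max (b x) 0) μ := fun ha hb =>
    ((memLp_top_max_zero hb).mul' (r := ⊤) (memLp_top_max_zero ha)).integrable le_top
  have hint₁ : ∀ {a : X → ℝ}, MemLp a ⊤ μ → Integrable (fun x => max (a x) 0) μ := fun ha =>
    (memLp_top_max_zero ha).integrable le_top
  have hfb_neg : MemLp (fun x => -f x) ⊤ μ := hfb.neg
  have hf'b_neg : MemLp (fun x => -f' x) ⊤ μ := hf'b.neg
  have hgb_neg : MemLp (fun x => -g x) ⊤ μ := hgb.neg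
  have hid : ProbabilityTheory.IdentDistrib f f' μ μ :=
    ⟨hf.aemeasurable, hf'.aemeasurable, hmap.symm⟩
  have hmap_neg : Measure.map (fun x => -f' x) μ = Measure.map (fun x => -f x) μ :=
    (hid.comp measurable_neg).map_eq.symm
  have hpos : ∫ x, max (f x) 0 ∂μ = ∫ x, max (f' x) 0 ∂μ :=
    (hid.comp (u := fun t => max t 0) (by fun_prop)).integral_eq
  have hneg : ∫ x, max (-f x) 0 ∂μ = ∫ x, max (-f' x) 0 ∂μ :=
    (hid.comp (u := fun t => max (-t) 0) (by fun_prop)).integral_eq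
  have h1 := integral_max_mul_max_le_of_monovary hf hf' hg hmap hfg (hint hf'b hgb)
  have h2 := integral_max_mul_max_le_of_monovary (b := fun x => -g x) hf.neg hf'.neg hg.neg
    hmap_neg (fun x y hxy => neg_le_neg (hfg (neg_lt_neg_iff.1 hxy))) (hint hf'b_neg hgb_neg)
  have h3 := integral_mul_le_of_antivary (a := fun x => max (-f' x) 0)
    (b := fun x => max (g x) 0) (hint₁ hf'b_neg) (hint₁ hgb) (hint hf'b_neg hgb)
    (fun x y hxy => max_le_max_right 0 (neg_le_neg (hfg (lt_of_not_ge fun h => hxy.not_ge (max_le_max_right 0 h)))))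
  have h4 := integral_mul_le_of_antivary (a := fun x => max (f' x) 0)
    (b := fun x => max (-g x) 0) (hint₁ hf'b) (hint₁ hgb_neg) (hint hf'b hgb_neg)
    (fun x y hxy => max_le_max_right 0 (hfg (neg_lt_neg_iff.1 (lt_of_not_ge fun h => hxy.not_ge (max_le_max_right 0 h)))))
  have h5 : ∫ x, f' x * g x ∂μ = (∫ x, max (f' x) 0 * max (g x) 0 ∂μ)
      + (∫ x, max (-f' x) 0 * max (-g x) 0 ∂μ) - (∫ x, max (-f' x) 0 * max (g x) 0 ∂μ)
      - ∫ x, max (f' x) 0 * max (-g x) 0 ∂μ := by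
    rw [← integral_add (hint hf'b hgb) (hint hf'b_neg hgb_neg),
      ← integral_sub ((hint hf'b hgb).fun_add (hint hf'b_neg hgb_neg)) (hint hf'b_neg hgb),
      ← integral_sub (((hint hf'b hgb).fun_add (hint hf'b_neg hgb_neg)).sub' (hint hf'b_neg hgb))
        (hint hf'b hgb_neg)]
    congr 1; ext x
    have e : ∀ t : ℝ, t = max t 0 - max (-t) 0 := fun t => by
      rcases le_total t 0 with h | h <;> simp [h]
    conv_lhs => rw [e (f' x), e (g x)]
    ring
  rw [integral_add (hint hfb hgb) (hint hfb_neg hgb_neg), hpos, hneg]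
  simp only [Pi.neg_apply] at h2
  linarith

/-- Lemma 7.5: for `f₀, ξ ∈ L^∞`,
`sup_{f ∼ f₀} ∫ |f ξ| ≤ 4 sup_{f ∼ f₀} |∫ f ξ| + 3 (⨍|f₀|) ∫ |ξ|`. -/
theorem stmt14 {X : Type*} [MeasurableSpace X] (μ : Measure X) [IsFiniteMeasure μ]
    (hμ : Nonatomic μ)
    (f₀ : X → ℝ) (hfm : Measurable f₀) (C₀ : ℝ) (hfb : ∀ x, |f₀ x| ≤ C₀)
    (ξ : X → ℝ) (hξm : Measurable ξ) (C : ℝ) (hξb : ∀ x, |ξ x| ≤ C) :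
    sSup {r : ℝ | ∃ f : X → ℝ, Measurable f ∧ Measure.map f μ = Measure.map f₀ μ ∧
        r = ∫ x, |f x * ξ x| ∂μ}
      ≤ 4 * sSup {r : ℝ | ∃ f : X → ℝ, Measurable f ∧
            Measure.map f μ = Measure.map f₀ μ ∧ r = |∫ x, f x * ξ x ∂μ|}
        + 3 * (⨍ x, |f₀ x| ∂μ) * ∫ x, |ξ x| ∂μ := by
  let S : Set ℝ := {r : ℝ | ∃ f : X → ℝ, Measurable f ∧
            Measure.map f μ = Measure.map f₀ μ ∧ r = |∫ x, f x * ξ x ∂μ|}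
  have hid : ∀ {f : X → ℝ}, Measurable f → Measure.map f μ = Measure.map f₀ μ →
      ProbabilityTheory.IdentDistrib f f₀ μ μ := fun hf h =>
    ⟨hf.aemeasurable, hfm.aemeasurable, h⟩
  have hbound : ∀ {f : X → ℝ}, Measurable f → Measure.map f μ = Measure.map f₀ μ →
      ∀ᵐ x ∂μ, |f x| ≤ C₀ := fun hf h =>
    (hid hf h).symm.ae_snd (p := fun t => |t| ≤ C₀)
      (measurableSet_le (by fun_prop) measurable_const) (Filter.Eventually.of_forall hfb)
  have hLp : ∀ {f : X → ℝ}, Measurable f → Measure.map f μ = Measure.map f₀ μ →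
      MemLp f ⊤ μ := fun hf h => memLp_top_of_bound hf.aestronglyMeasurable C₀ (hbound hf h)
  have hξLp : MemLp ξ ⊤ μ :=
    memLp_top_of_bound hξm.aestronglyMeasurable C (Filter.Eventually.of_forall hξb)
  have hmulInt : ∀ {a b : X → ℝ}, MemLp a ⊤ μ → MemLp b ⊤ μ →
      Integrable (fun x => a x * b x) μ := fun ha hb =>
    (hb.mul' (r := ⊤) ha).integrable le_top
  have hbdd : BddAbove S := by
    refine ⟨C₀ * C * μ.real Set.univ, ?_⟩
    rintro _ ⟨f, hf, hmap, rfl⟩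
    refine norm_integral_le_of_norm_le_const (μ := μ) (f := fun x => f x * ξ x) ?_
    filter_upwards [hbound hf hmap] with x hx
    rw [norm_mul]
    exact mul_le_mul hx (hξb x) (abs_nonneg _) ((abs_nonneg _).trans hx)
  have hS : ∀ {f : X → ℝ}, Measurable f → Measure.map f μ = Measure.map f₀ μ →
      |∫ x, f x * ξ x ∂μ| ≤ sSup S := fun hf h => le_csSup hbdd ⟨_, hf, h, rfl⟩
  have hS0 : 0 ≤ sSup S := (abs_nonneg _).trans (hS hfm rfl)
  have hI0 : 0 ≤ ∫ x, |f₀ x| ∂μ := integral_nonneg fun x => abs_nonneg _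
  have hJ0 : 0 ≤ ∫ x, |ξ x| ∂μ := integral_nonneg fun x => abs_nonneg _
  have hM0 : 0 ≤ μ.real Set.univ := measureReal_nonneg
  refine csSup_le ⟨_, f₀, hfm, rfl, rfl⟩ ?_
  rintro _ ⟨f, hf, hmap, rfl⟩
  rw [average_eq, smul_eq_mul]
  suffices h : ∫ x, |f x * ξ x| ∂μ
      ≤ 2 * sSup S + (μ.real Set.univ)⁻¹ * (∫ x, |f₀ x| ∂μ) * ∫ x, |ξ x| ∂μ by
    have : 0 ≤ (μ.real Set.univ)⁻¹ * (∫ x, |f₀ x| ∂μ) * ∫ x, |ξ x| ∂μ := by positivity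
    change _ ≤ 4 * sSup S + _
    linarith
  let K : ℝ := 3 * (C₀ * μ.real Set.univ)
    + (μ.real Set.univ)⁻¹ * (∫ x, |f₀ x| ∂μ) * μ.real Set.univ
  suffices h : ∀ δ : ℝ, 0 < δ → ∫ x, |f x * ξ x| ∂μ
      ≤ 2 * sSup S + (μ.real Set.univ)⁻¹ * (∫ x, |f₀ x| ∂μ) * (∫ x, |ξ x| ∂μ) + δ * K by
    have ht : Filter.Tendsto (fun δ : ℝ => 2 * sSup S
        + (μ.real Set.univ)⁻¹ * (∫ x, |f₀ x| ∂μ) * (∫ x, |ξ x| ∂μ) + δ * K)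
        (nhdsWithin 0 (Set.Ioi 0)) (nhds (2 * sSup S
        + (μ.real Set.univ)⁻¹ * (∫ x, |f₀ x| ∂μ) * (∫ x, |ξ x| ∂μ) + 0 * K)) :=
      (Continuous.tendsto (by fun_prop) 0).mono_left nhdsWithin_le_nhds
    rw [zero_mul, add_zero] at ht
    refine ge_of_tendsto ht ?_
    filter_upwards [self_mem_nhdsWithin] with δ hδ using h δ hδ
  intro δ hδ
  let k : X → ℤ := fun x => ⌊ξ x / δ⌋
  have hk : Measurable k := Int.measurable_floor.comp (hξm.div_const δ)
  let g : X → ℝ := fun x => δ * k x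
  have hgm : Measurable g :=
    ((measurable_from_top (f := fun n : ℤ => (n : ℝ))).comp hk).const_mul δ
  have hgk : ∀ {x y}, g x < g y → k x < k y := fun h => by
    exact_mod_cast lt_of_mul_lt_mul_left h hδ.le
  have hgξ : ∀ x, |g x - ξ x| ≤ δ := fun x => by
    have h1 := Int.floor_le (ξ x / δ)
    have h2 := Int.lt_floor_add_one (ξ x / δ)
    rw [le_div_iff₀ hδ] at h1
    rw [div_lt_iff₀ hδ] at h2
    rw [abs_le]
    constructor <;> simp only [g, k] <;> nlinarith
  have hgLp : MemLp g ⊤ μ := by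
    refine memLp_top_of_bound hgm.aestronglyMeasurable (C + δ) (Filter.Eventually.of_forall ?_)
    intro x
    have h1 := abs_add_le (ξ x) (g x - ξ x)
    rw [add_sub_cancel] at h1
    exact h1.trans (add_le_add (hξb x) (hgξ x))
  have hswap : ∀ {a : X → ℝ}, Measurable a → Measure.map a μ = Measure.map f₀ μ →
      |(∫ x, a x * g x ∂μ) - ∫ x, a x * ξ x ∂μ| ≤ δ * (C₀ * μ.real Set.univ) := by
    intro a ha hma
    rw [← integral_sub (hmulInt (hLp ha hma) hgLp) (hmulInt (hLp ha hma) hξLp)]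
    have h1 := norm_integral_le_of_norm_le_const (μ := μ)
      (f := fun x => a x * g x - a x * ξ x) (C := C₀ * δ) ?_
    · rw [Real.norm_eq_abs] at h1
      linarith
    · filter_upwards [hbound ha hma] with x hx
      rw [← mul_sub, norm_mul]
      exact mul_le_mul hx (hgξ x) (abs_nonneg _) ((abs_nonneg _).trans hx)
  obtain ⟨f₁, hf₁, hmap₁, hmono₁⟩ := hμ.exists_monovary hfm hfb hk
  obtain ⟨f₂, hf₂, hmap₂, hmono₂⟩ := hμ.exists_monovary (f := fun x => -f₀ x) hfm.neg
    (fun x => (abs_neg (f₀ x)).trans_le (hfb x)) hk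
  have hmap₂' : Measure.map (fun x => -f₂ x) μ = Measure.map f₀ μ := by
    have h : ProbabilityTheory.IdentDistrib f₂ (fun x => -f₀ x) μ μ :=
      ⟨hf₂.aemeasurable, hfm.neg.aemeasurable, hmap₂⟩
    simpa [Function.comp_def] using (h.comp measurable_neg).map_eq
  have hmapneg : Measure.map (fun x => -f x) μ = Measure.map (fun x => -f₀ x) μ :=
    ((hid hf hmap).comp measurable_neg).map_eq
  have hf₂Lp : MemLp f₂ ⊤ μ := by simpa using (hLp hf₂.neg hmap₂').neg
  have h1 := integral_max_mul_max_add_le hf hf₁ hgm (hmap₁.trans hmap.symm)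
    (fun x y hxy => hmono₁ (hgk hxy)) (hLp hf hmap) (hLp hf₁ hmap₁) hgLp
  have h2 := integral_max_mul_max_add_le (f := fun x => -f x) hf.neg hf₂ hgm
    (hmap₂.trans hmapneg.symm) (fun x y hxy => hmono₂ (hgk hxy)) (hLp hf hmap).neg hf₂Lp hgLp
  simp only [neg_neg] at h2
  have hnegLp : ∀ {a : X → ℝ}, MemLp a ⊤ μ → MemLp (fun x => -a x) ⊤ μ := fun ha => ha.neg
  have hmaxInt : ∀ {a b : X → ℝ}, MemLp a ⊤ μ → MemLp b ⊤ μ →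
      Integrable (fun x => max (a x) 0 * max (b x) 0) μ := fun ha hb =>
    hmulInt (memLp_top_max_zero ha) (memLp_top_max_zero hb)
  have habs : ∀ {a : X → ℝ}, MemLp a ⊤ μ →
      (∫ x, max (a x) 0 ∂μ) + ∫ x, max (-a x) 0 ∂μ = ∫ x, |a x| ∂μ := fun {a} ha => by
    rw [← integral_add ((memLp_top_max_zero ha).integrable le_top)
      ((memLp_top_max_zero (hnegLp ha)).integrable le_top)]
    congr 1; ext x
    rcases le_total (a x) 0 with h | h <;> simp [h, abs_of_nonneg, abs_of_nonpos]
  have hfLp := hLp hf hmap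
  have h3 : ∫ x, |f x * g x| ∂μ
      = (∫ x, (max (f x) 0 * max (g x) 0 + max (-f x) 0 * max (-g x) 0) ∂μ)
        + ∫ x, (max (-f x) 0 * max (g x) 0 + max (f x) 0 * max (-g x) 0) ∂μ := by
    rw [← integral_add ((hmaxInt hfLp hgLp).fun_add (hmaxInt (hnegLp hfLp) (hnegLp hgLp)))
      ((hmaxInt (hnegLp hfLp) hgLp).fun_add (hmaxInt hfLp (hnegLp hgLp)))]
    congr 1; ext x
    rw [abs_mul]
    rcases le_total (f x) 0 with h | h <;> rcases le_total (g x) 0 with h' | h' <;>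
      simp [h, h', abs_of_nonneg, abs_of_nonpos]
  have h4 : ∫ x, |f x * ξ x| ∂μ ≤ (∫ x, |f x * g x| ∂μ) + δ * (C₀ * μ.real Set.univ) := by
    have h5 : ∫ x, |f x * ξ x| ∂μ ≤ ∫ x, (|f x * g x| + C₀ * δ) ∂μ := by
      refine integral_mono_ae (hmulInt hfLp hξLp).abs
        ((hmulInt hfLp hgLp).abs.fun_add (integrable_const _)) ?_
      filter_upwards [hbound hf hmap] with x hx
      have h6 : |f x * (ξ x - g x)| ≤ C₀ * δ := by
        rw [abs_mul, abs_sub_comm]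
        exact mul_le_mul hx (hgξ x) (abs_nonneg _) ((abs_nonneg _).trans hx)
      have h7 := abs_add_le (f x * g x) (f x * (ξ x - g x))
      rw [← mul_add, add_sub_cancel] at h7
      linarith
    rw [integral_add (hmulInt hfLp hgLp).abs (integrable_const _), integral_const,
      smul_eq_mul] at h5
    linarith
  have h5 : ∫ x, |g x| ∂μ ≤ (∫ x, |ξ x| ∂μ) + δ * μ.real Set.univ := by
    have h6 : ∫ x, |g x| ∂μ ≤ ∫ x, (|ξ x| + δ) ∂μ := by
      refine integral_mono (hgLp.integrable le_top).abs
        ((hξLp.integrable le_top).abs.fun_add (integrable_const _)) fun x => ?_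
      have h7 := abs_add_le (ξ x) (g x - ξ x)
      rw [add_sub_cancel] at h7
      exact h7.trans (add_le_add_right (hgξ x) _)
    rw [integral_add (hξLp.integrable le_top).abs (integrable_const _), integral_const,
      smul_eq_mul] at h6
    linarith
  have h6 : ∫ x, |f x| ∂μ = ∫ x, |f₀ x| ∂μ := (hid hf hmap).norm.integral_eq
  have h7 := (abs_le.1 (hswap hf₁ hmap₁)).2
  have h8 := (abs_le.1 (hswap hf₂.neg hmap₂')).1
  have h9 := (abs_le.1 (hS hf₁ hmap₁)).2
  have h10 := (abs_le.1 (hS hf₂.neg hmap₂')).1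
  simp only [Pi.neg_apply, neg_mul, integral_neg] at h8 h10
  have h11 : (∫ x, max (-f x) 0 ∂μ) * (∫ x, max (g x) 0 ∂μ)
      + (∫ x, max (f x) 0 ∂μ) * (∫ x, max (-g x) 0 ∂μ)
      + ((∫ x, max (f x) 0 ∂μ) * (∫ x, max (g x) 0 ∂μ)
      + (∫ x, max (-f x) 0 ∂μ) * (∫ x, max (-g x) 0 ∂μ))
      = (∫ x, |f₀ x| ∂μ) * ∫ x, |g x| ∂μ := by
    rw [← h6, ← habs hfLp, ← habs hgLp]
    ring
  have h12 : (μ.real Set.univ)⁻¹ * ((∫ x, |f₀ x| ∂μ) * ∫ x, |g x| ∂μ)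
      ≤ (μ.real Set.univ)⁻¹ * ((∫ x, |f₀ x| ∂μ)
        * ((∫ x, |ξ x| ∂μ) + δ * μ.real Set.univ)) := by
    gcongr
  rw [← h11] at h12
  simp only [K]
  linarith
end
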